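/- arXiv:2208.09426 — 3 statements merged into one kernel-verified Lean document; each statement's English description precedes it below -/
import Mathlib

section
/- Let X_1, X_2, ... be i.i.d. random vectors in R^q and let f : R^q → R^r be measurable with E‖f(X_1 - X_2)‖² < ∞. Let Π be a uniformly distributed random permutation of {1,...,n}, independent of (X_i)_{i=1}^n, with the convention Π(n+1) := Π(1), and define M̃_{n,1} := n^{-1} Σ_{i=1}^n f_2(X_{Π(i)}, X_{Π(i+1)}). Then the Lévy–Prokhorov distance between the conditional distribution of √n · M̃_{n,1} given (X_i)_{i=1}^n and the Gaussian distribution N_r(0, Γ_2) converges to zero in probability as n → ∞. -/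
open MeasureTheory ProbabilityTheory Finset Filter
open scoped ENNReal Topology RealInnerProductSpace

noncomputable section

/-- Symmetrization `f^s(x) := (f(x) + f(-x))/2`. -/
def fS {q r : ℕ} (f : EuclideanSpace ℝ (Fin q) → EuclideanSpace ℝ (Fin r))
    (x : EuclideanSpace ℝ (Fin q)) : EuclideanSpace ℝ (Fin r) :=
  (2 : ℝ)⁻¹ • (f x + f (-x))

/-- `f_0 := E f(X_1 - X_2)`. -/
def f0v {Ω : Type*} [MeasurableSpace Ω] {q r : ℕ} (P : Measure Ω)
    (X : ℕ → Ω → EuclideanSpace ℝ (Fin q))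
    (f : EuclideanSpace ℝ (Fin q) → EuclideanSpace ℝ (Fin r)) : EuclideanSpace ℝ (Fin r) :=
  ∫ ω, f (X 0 ω - X 1 ω) ∂P

/-- `f_1(x) := E f^s(x - X_1) - f_0`. -/
def f1v {Ω : Type*} [MeasurableSpace Ω] {q r : ℕ} (P : Measure Ω)
    (X : ℕ → Ω → EuclideanSpace ℝ (Fin q))
    (f : EuclideanSpace ℝ (Fin q) → EuclideanSpace ℝ (Fin r))
    (x : EuclideanSpace ℝ (Fin q)) : EuclideanSpace ℝ (Fin r) :=
  (∫ ω, fS f (x - X 0 ω) ∂P) - f0v P X f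

/-- `f_2(x,y) := f^s(x - y) - f_0 - f_1(x) - f_1(y)`. -/
def f2v {Ω : Type*} [MeasurableSpace Ω] {q r : ℕ} (P : Measure Ω)
    (X : ℕ → Ω → EuclideanSpace ℝ (Fin q))
    (f : EuclideanSpace ℝ (Fin q) → EuclideanSpace ℝ (Fin r))
    (x y : EuclideanSpace ℝ (Fin q)) : EuclideanSpace ℝ (Fin r) :=
  fS f (x - y) - f0v P X f - f1v P X f x - f1v P X f y

/-- The covariance matrix of an `ℝ^r`-valued random vector. -/
def covM {Ω : Type*} [MeasurableSpace Ω] {r : ℕ} (P : Measure Ω)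
    (Y : Ω → EuclideanSpace ℝ (Fin r)) : Matrix (Fin r) (Fin r) ℝ :=
  Matrix.of fun a b =>
    ∫ ω, (Y ω a - ∫ ω', Y ω' a ∂P) * (Y ω b - ∫ ω', Y ω' b ∂P) ∂P

/-- Loewner partial order: `A ≤ B` iff `B - A` is positive semidefinite. -/
def LoewnerLE {r : ℕ} (A B : Matrix (Fin r) (Fin r) ℝ) : Prop := (B - A).PosSemidef


/-- The quadratic form `a ↦ aᵀ Γ a` of a covariance matrix. -/
def quadForm {r : ℕ} (Γ : Matrix (Fin r) (Fin r) ℝ) (a : EuclideanSpace ℝ (Fin r)) : ℝ :=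
  ∑ i, ∑ j, a i * Γ i j * a j

/-- The conditional law of `√n M̃_{n,1}` given the data: `Π` is uniform on the permutations
of `{1,...,n}` and independent of the data, so conditionally on `(X_i)_i = (x_i)_i` the
random vector `√n M̃_{n,1} = n^{-1/2} ∑_i f_2(x_{Π(i)}, x_{Π(i+1)})` (cyclically) has this
law. -/
def condLawPerm {Ω : Type*} [MeasurableSpace Ω] {q r : ℕ} (P : Measure Ω) (n : ℕ)
    (X : ℕ → Ω → EuclideanSpace ℝ (Fin q))
    (f : EuclideanSpace ℝ (Fin q) → EuclideanSpace ℝ (Fin r)) (ω : Ω) :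
    Measure (EuclideanSpace ℝ (Fin r)) :=
  ((n.factorial : ℕ) : ℝ≥0∞)⁻¹ •
    ∑ π : Equiv.Perm (Fin n),
      Measure.dirac ((Real.sqrt n)⁻¹ •
        ∑ i : Fin n, f2v P X f (X (π i) ω) (X (π (finRotate n i)) ω))


lemma pc_comap_pi {Ω E : Type*} [MeasurableSpace E] (m : MeasurableSpace Ω) (Z : Ω → ℕ → E)
    (h : ∀ k, MeasurableSpace.comap (fun ω => Z ω k) inferInstance ≤ m) :
    MeasurableSpace.comap Z inferInstance ≤ m :=
  (measurable_pi_lambda Z fun k => measurable_iff_comap_le.2 (h k)).comap_le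

lemma pc_indep {Ω E : Type*} [MeasurableSpace Ω] [MeasurableSpace E] {P : Measure Ω}
    {X : ℕ → Ω → E} (hXm : ∀ i, Measurable (X i)) (hindep : iIndepFun X P)
    (S : Finset ℕ) (x0 : E) :
    IndepFun (fun ω (k : ℕ) => if k ∈ S then X k ω else x0)
      (fun ω (k : ℕ) => if k ∈ S then x0 else X k ω) P := by
  rw [IndepFun_iff_Indep]
  have h := indep_iSup_of_disjoint (fun i => (hXm i).comap_le) hindep
    (S := (S : Set ℕ)) (T := (S : Set ℕ)ᶜ) disjoint_compl_right
  refine indep_of_indep_of_le_left (indep_of_indep_of_le_right h ?_) ?_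
  · refine pc_comap_pi _ _ fun k => ?_
    by_cases hk : k ∈ S
    · simp only [hk, if_true]; simp
    · simp only [hk, if_false]
      exact le_iSup₂_of_le (f := fun i (_ : i ∈ ((S : Set ℕ)ᶜ)) => _) k (by simpa using hk) le_rfl
  · refine pc_comap_pi _ _ fun k => ?_
    by_cases hk : k ∈ S
    · simp only [hk, if_true]
      exact le_iSup₂_of_le (f := fun i (_ : i ∈ ((S : Set ℕ))) => _) k (by simpa using hk) le_rfl
    · simp only [hk, if_false]; simp

lemma pc_meas2 {α E : Type*} [MeasurableSpace α] [MeasurableSpace E] {v : E → E → ℝ}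
    (hv : Measurable (Function.uncurry v)) {u w : α → E} (hu : Measurable u) (hw : Measurable w) :
    Measurable fun z => v (u z) (w z) :=
  Measurable.comp (g := Function.uncurry v) (f := fun z => (u z, w z)) hv (hu.prodMk hw)

/-- degenerate kernel times a function not depending on coordinate `a`. -/
lemma pc_zero {Ω E : Type*} [MeasurableSpace Ω] [MeasurableSpace E] {P : Measure Ω}
    [IsProbabilityMeasure P] {μ : Measure E}
    {X : ℕ → Ω → E} (hXm : ∀ i, Measurable (X i)) (hindep : iIndepFun X P)
    (hμ : ∀ i, Measure.map (X i) P = μ) {v : E → E → ℝ} (hv : Measurable (Function.uncurry v))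
    (hv0 : ∀ᵐ y ∂μ, ∫ x, v x y ∂μ = 0) {a b : ℕ} (hab : a ≠ b)
    {G : (ℕ → E) → ℂ} (hG : Measurable G) (hGa : ∀ z x, G (Function.update z a x) = G z)
    (hint : Integrable (fun ω => (v (X a ω) (X b ω) : ℂ) * G (fun k => X k ω)) P) :
    ∫ ω, (v (X a ω) (X b ω) : ℂ) * G (fun k => X k ω) ∂P = 0 := by
  have hprob : IsProbabilityMeasure μ := by
    rw [← hμ 0]; exact Measure.isProbabilityMeasure_map (hXm 0).aemeasurable
  obtain ⟨ω0⟩ : Nonempty Ω := nonempty_of_isProbabilityMeasure P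
  set x0 := X 0 ω0
  set Z : Ω → (ℕ → E) := fun ω k => if k ∈ ({a} : Finset ℕ) then x0 else X k ω with hZ
  have hZm : Measurable Z := by
    refine measurable_pi_lambda _ fun k => ?_
    by_cases hk : k ∈ ({a} : Finset ℕ)
    · simp only [hZ, hk, if_true]; exact measurable_const
    · simp only [hZ, hk, if_false]; exact hXm k
  have hGZ : ∀ ω, G (fun k => X k ω) = G (Z ω) := by
    intro ω
    rw [← hGa (fun k => X k ω) x0]
    congr 1
    funext k
    simp [hZ, Function.update_apply]
  have hbZ : ∀ ω, X b ω = Z ω b := by intro ω; simp [hZ, hab.symm]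
  have hI : IndepFun (X a) Z P := by
    have := (pc_indep hXm hindep {a} x0).comp (measurable_pi_apply a) measurable_id
    convert this using 1
    · funext ω; simp
    · rfl
  have hmap := (indepFun_iff_map_prod_eq_prod_map_map (hXm a).aemeasurable hZm.aemeasurable).1 hI
  rw [hμ a] at hmap
  set ν := P.map Z
  have hν : IsProbabilityMeasure ν := Measure.isProbabilityMeasure_map hZm.aemeasurable
  have hF : Measurable (fun p : E × (ℕ → E) => (v p.1 (p.2 b) : ℂ) * G p.2) := by
    refine Measurable.mul ?_ (hG.comp measurable_snd)
    exact Complex.measurable_ofReal.comp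
      (hv.comp (measurable_fst.prodMk ((measurable_pi_apply b).comp measurable_snd)))
  have hpair : Measurable (fun ω => (X a ω, Z ω)) := (hXm a).prodMk hZm
  have e1 : (fun ω => (v (X a ω) (X b ω) : ℂ) * G (fun k => X k ω))
      = (fun p : E × (ℕ → E) => (v p.1 (p.2 b) : ℂ) * G p.2) ∘ (fun ω => (X a ω, Z ω)) := by
    funext ω; simp [hGZ, hbZ]
  rw [e1] at hint ⊢
  rw [← integrable_map_measure hF.aestronglyMeasurable hpair.aemeasurable, hmap] at hint
  simp only [Function.comp_def]
  rw [← integral_map (f := fun p : E × (ℕ → E) => (v p.1 (p.2 b) : ℂ) * G p.2)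
    hpair.aemeasurable hF.aestronglyMeasurable, hmap]
  rw [integral_prod_symm _ hint]
  have hνb : ν.map (fun z => z b) = μ := by
    rw [Measure.map_map (measurable_pi_apply b) hZm, ← hμ b]
    congr 1; funext ω; simp [hbZ]
  have h0 : ∀ᵐ z ∂ν, ∫ x, v x (z b) ∂μ = 0 := by
    rw [← hνb] at hv0
    have := ae_of_ae_map (measurable_pi_apply b).aemeasurable hv0
    rw [hνb] at this
    exact this
  rw [integral_eq_zero_of_ae]
  filter_upwards [h0] with z hz
  simp only [Pi.zero_apply]
  rw [integral_mul_const, integral_complex_ofReal, hz]; simp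

lemma pc_prod {Ω E : Type*} [MeasurableSpace Ω] [MeasurableSpace E] {P : Measure Ω}
    [IsProbabilityMeasure P]
    {X : ℕ → Ω → E} (hXm : ∀ i, Measurable (X i)) (hindep : iIndepFun X P)
    {v : E → E → ℝ} (hv : Measurable (Function.uncurry v)) {a b : ℕ}
    {G : (ℕ → E) → ℂ} (hG : Measurable G) (hGa : ∀ z x, G (Function.update z a x) = G z)
    (hGb : ∀ z x, G (Function.update z b x) = G z) :
    ∫ ω, (v (X a ω) (X b ω) : ℂ) * G (fun k => X k ω) ∂P =
      ((∫ ω, v (X a ω) (X b ω) ∂P : ℝ) : ℂ) * ∫ ω, G (fun k => X k ω) ∂P := by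
  obtain ⟨ω0⟩ : Nonempty Ω := nonempty_of_isProbabilityMeasure P
  set x0 := X 0 ω0
  have hI := pc_indep hXm hindep {a, b} x0
  have hGZ : ∀ ω, G (fun k => X k ω) = G (fun k => if k ∈ ({a, b} : Finset ℕ) then x0 else X k ω) := by
    intro ω
    rw [← hGa (fun k => X k ω) x0, ← hGb _ x0]
    congr 1
    funext k
    simp only [Function.update_apply, Finset.mem_insert, Finset.mem_singleton]
    split_ifs <;> simp_all
  have hvm : Measurable (fun z : ℕ → E => (v (z a) (z b) : ℂ)) :=
    Complex.measurable_ofReal.comp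
      (pc_meas2 hv (measurable_pi_apply a) (measurable_pi_apply b))
  have h2 := hI.comp hvm hG
  have := h2.integral_fun_mul_eq_mul_integral ?_ ?_
  · simp only [Function.comp_def, ← hGZ] at this
    simp only [Finset.mem_insert, Finset.mem_singleton, true_or, or_true, if_true] at this
    rw [this, integral_complex_ofReal]
  · refine (hvm.comp ?_).aestronglyMeasurable
    refine measurable_pi_lambda _ fun k => ?_
    by_cases hk : k ∈ ({a, b} : Finset ℕ)
    · simp only [hk, if_true]; exact hXm k
    · simp only [hk, if_false]; exact measurable_const
  · refine (hG.comp ?_).aestronglyMeasurable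
    refine measurable_pi_lambda _ fun k => ?_
    by_cases hk : k ∈ ({a, b} : Finset ℕ)
    · simp only [hk, if_true]; exact measurable_const
    · simp only [hk, if_false]; exact hXm k

lemma pc_exp_bound (x : ℝ) : ‖Complex.exp (Complex.I * x) - 1 - Complex.I * x‖ ≤ 2 * x ^ 2 := by
  by_cases h : |x| ≤ 1
  · have := Complex.norm_exp_sub_one_sub_id_le (x := Complex.I * x) (by simpa using h)
    refine this.trans ?_
    simp; nlinarith [sq_nonneg x]
  · push Not at h
    have h1 := Real.norm_exp_I_mul_ofReal_sub_one_le (x := x)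
    calc _ ≤ ‖Complex.exp (Complex.I * x) - 1‖ + ‖Complex.I * (x : ℂ)‖ := norm_sub_le _ _
      _ ≤ |x| + |x| := by gcongr; · simpa using h1
                          · simp
      _ ≤ _ := by nlinarith [sq_abs x]



def pcN {ι : Type*} [Fintype ι] (a b : ι → ℕ) (e : ι) : Finset ι :=
  univ.filter fun e' => a e' = a e ∨ a e' = b e ∨ b e' = a e ∨ b e' = b e

def pcM {ι : Type*} [Fintype ι] [DecidableEq ι] (a b : ι → ℕ) (e : ι) : Finset ι :=
  univ.filter fun e' => e' ≠ e ∧ ((a e' = a e ∧ b e' = b e) ∨ (a e' = b e ∧ b e' = a e))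

lemma pc_edge {Ω E ι : Type*} [MeasurableSpace Ω] [MeasurableSpace E] {P : Measure Ω}
    [IsProbabilityMeasure P] {μ : Measure E} [Fintype ι] [DecidableEq ι]
    {X : ℕ → Ω → E} (hXm : ∀ i, Measurable (X i)) (hindep : iIndepFun X P)
    (hμ : ∀ i, Measure.map (X i) P = μ)
    (a b : ι → ℕ) (hab : ∀ e, a e ≠ b e) (y : ι → E → E → ℝ)
    (hy : ∀ e, Measurable (Function.uncurry (y e)))
    (hy1 : ∀ e, ∀ᵐ x ∂μ, ∫ z, y e z x ∂μ = 0) (hy2 : ∀ e, ∀ᵐ x ∂μ, ∫ z, y e x z ∂μ = 0)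
    (B : ℝ) (hB : ∀ e x z, |y e x z| ≤ B) (D : ℕ) (hD : ∀ e, (pcN a b e).card ≤ D)
    (t : ℝ) (e : ι) :
    ‖(∫ ω, (y e (X (a e) ω) (X (b e) ω) : ℂ) *
        Complex.exp (Complex.I * ((t * ∑ e', y e' (X (a e') ω) (X (b e') ω) : ℝ) : ℂ)) ∂P)
      - Complex.I * t * ((∫ ω, (y e (X (a e) ω) (X (b e) ω)) ^ 2 ∂P : ℝ) : ℂ) *
        ∫ ω, Complex.exp (Complex.I * ((t * ∑ e', y e' (X (a e') ω) (X (b e') ω) : ℝ) : ℂ)) ∂P‖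
      ≤ 2 * t ^ 2 * D ^ 2 * B ^ 3 + |t| * B ^ 2 * (pcM a b e).card + t ^ 2 * D * B ^ 3 := by
  have hprob : IsProbabilityMeasure μ := by
    rw [← hμ 0]; exact Measure.isProbabilityMeasure_map (hXm 0).aemeasurable
  have hB0 : 0 ≤ B := by
    obtain ⟨x⟩ : Nonempty E := nonempty_of_isProbabilityMeasure μ
    exact (abs_nonneg _).trans (hB e x x)
  set Y : ι → Ω → ℝ := fun e ω => y e (X (a e) ω) (X (b e) ω) with hY
  have hYm : ∀ e, Measurable (Y e) := fun e => pc_meas2 (hy e) (hXm _) (hXm _)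
  have hYB : ∀ e ω, |Y e ω| ≤ B := fun e ω => hB _ _ _
  set N := pcN a b e with hN
  set We : Ω → ℝ := fun ω => ∑ e' ∈ Nᶜ, Y e' ω with hWe
  set R : Ω → ℝ := fun ω => ∑ e' ∈ N, Y e' ω with hR
  have hWR : ∀ ω, ∑ e', Y e' ω = We ω + R ω := by
    intro ω; simp only [hWe, hR]; rw [add_comm, Finset.sum_add_sum_compl]
  have hWem : Measurable We := Finset.measurable_fun_sum _ fun e _ => hYm e
  have hRm : Measurable R := Finset.measurable_fun_sum _ fun e _ => hYm e
  have hRB : ∀ ω, |R ω| ≤ D * B := by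
    intro ω
    calc |R ω| ≤ ∑ e' ∈ N, |Y e' ω| := Finset.abs_sum_le_sum_abs _ _
      _ ≤ ∑ e' ∈ N, B := Finset.sum_le_sum fun e' _ => hYB e' ω
      _ = N.card * B := by simp
      _ ≤ D * B := by gcongr; exact hD e
  set U : Ω → ℂ := fun ω => Complex.exp (Complex.I * ((t * We ω : ℝ) : ℂ)) with hU
  have hUm : Measurable U := by
    simp only [hU]; fun_prop
  have nexp : ∀ x : ℝ, ‖Complex.exp (Complex.I * (x : ℂ))‖ = 1 := fun x => by
    rw [mul_comm]; exact Complex.norm_exp_ofReal_mul_I x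
  have hUn : ∀ ω, ‖U ω‖ = 1 := fun ω => nexp _
  set ρ : Ω → ℂ := fun ω => Complex.exp (Complex.I * ((t * R ω : ℝ) : ℂ)) - 1
    - Complex.I * ((t * R ω : ℝ) : ℂ) with hρ
  have hρm : Measurable ρ := by simp only [hρ]; fun_prop
  have hρB : ∀ ω, ‖ρ ω‖ ≤ 2 * t ^ 2 * (D * B) ^ 2 := by
    intro ω
    refine (pc_exp_bound _).trans ?_
    rw [mul_pow, ← sq_abs (R ω)]
    have := hRB ω
    have : |R ω| ^ 2 ≤ (D * B) ^ 2 := by gcongr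
    nlinarith [sq_nonneg t]
  have hVU : ∀ ω, Complex.exp (Complex.I * ((t * ∑ e', Y e' ω : ℝ) : ℂ))
      = U ω * Complex.exp (Complex.I * ((t * R ω : ℝ) : ℂ)) := by
    intro ω
    rw [hWR, hU, ← Complex.exp_add]; congr 1; push_cast; ring
  -- G as a function of the sequence
  set Uf : (ℕ → E) → ℂ := fun z =>
    Complex.exp (Complex.I * ((t * ∑ e' ∈ Nᶜ, y e' (z (a e')) (z (b e')) : ℝ) : ℂ)) with hUf
  have hyf : ∀ e', Measurable fun z : ℕ → E => y e' (z (a e')) (z (b e')) := fun e' =>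
    pc_meas2 (hy e') (measurable_pi_apply _) (measurable_pi_apply _)
  have hUfm : Measurable Uf := by
    have : Measurable fun z : ℕ → E => ∑ e' ∈ Nᶜ, y e' (z (a e')) (z (b e')) :=
      Finset.measurable_fun_sum _ fun e _ => hyf e
    simp only [hUf]; fun_prop
  have hNc : ∀ e' ∈ Nᶜ, a e' ≠ a e ∧ a e' ≠ b e ∧ b e' ≠ a e ∧ b e' ≠ b e := by
    intro e' he'
    simpa [hN, pcN] using he'
  have hUfa : ∀ z x, Uf (Function.update z (a e) x) = Uf z := by
    intro z x
    simp only [hUf]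
    congr 4
    refine Finset.sum_congr rfl fun e' he' => ?_
    obtain ⟨h1, h2, h3, h4⟩ := hNc e' he'
    simp [Function.update_of_ne, h1, h3]
  have hUfb : ∀ z x, Uf (Function.update z (b e) x) = Uf z := by
    intro z x
    simp only [hUf]
    congr 4
    refine Finset.sum_congr rfl fun e' he' => ?_
    obtain ⟨h1, h2, h3, h4⟩ := hNc e' he'
    simp [Function.update_of_ne, h2, h4]
  have hYc : ∀ e, Measurable fun ω => (Y e ω : ℂ) := fun e => Complex.measurable_ofReal.comp (hYm e)
  have hYcB : ∀ e ω, ‖(Y e ω : ℂ)‖ ≤ B := fun e ω => by simpa using hYB e ω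
  have intYU : ∀ e', Integrable (fun ω => (Y e' ω : ℂ) * U ω) P := fun e' =>
    Integrable.of_bound ((hYc e').mul hUm).aestronglyMeasurable B
      (ae_of_all _ fun ω => by rw [norm_mul, hUn, mul_one]; exact hYcB e' ω)
  have nYYU : ∀ e' ω, ‖(Y e ω : ℂ) * ((Y e' ω : ℂ) * U ω)‖ ≤ B ^ 2 := fun e' ω => by
    rw [norm_mul, norm_mul, hUn, mul_one, sq]
    gcongr
    · exact hYcB e ω
    · exact hYcB e' ω
  have intYYU : ∀ e', Integrable (fun ω => (Y e ω : ℂ) * ((Y e' ω : ℂ) * U ω)) P := fun e' =>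
    Integrable.of_bound ((hYc e).mul ((hYc e').mul hUm)).aestronglyMeasurable (B ^ 2)
      (ae_of_all _ fun ω => nYYU e' ω)
  have z1 : ∫ ω, (Y e ω : ℂ) * U ω ∂P = 0 :=
    pc_zero hXm hindep hμ (hy e) (hy1 e) (hab e) hUfm hUfa (intYU e)
  have z2 : ∀ e', e' ≠ e → e' ∉ pcM a b e →
      ∫ ω, (Y e ω : ℂ) * ((Y e' ω : ℂ) * U ω) ∂P = 0 := by
    intro e' hne hM
    have hGm : Measurable fun z : ℕ → E => (y e' (z (a e')) (z (b e')) : ℂ) * Uf z :=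
      (Complex.measurable_ofReal.comp (hyf e')).mul hUfm
    by_cases h1 : a e' ≠ a e ∧ b e' ≠ a e
    · refine pc_zero hXm hindep hμ (hy e) (hy1 e) (hab e) hGm ?_ (intYYU e')
      intro z x
      rw [hUfa]; simp [Function.update_of_ne, h1.1, h1.2]
    · have h2 : a e' ≠ b e ∧ b e' ≠ b e := by
        have := hab e; have := hab e'
        simp only [pcM, Finset.mem_filter, Finset.mem_univ, true_and] at hM
        constructor
        · intro h; exact hM ⟨hne, Or.inr ⟨h, by grind⟩⟩
        · intro h; exact hM ⟨hne, Or.inl ⟨by grind, h⟩⟩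
      refine pc_zero (v := fun x z => y e z x) hXm hindep hμ ((hy e).comp measurable_swap) (hy2 e)
        (hab e).symm hGm ?_ (intYYU e')
      intro z x
      rw [hUfb]; simp [Function.update_of_ne, h2.1, h2.2]
  have z3 : ∫ ω, (Y e ω : ℂ) * ((Y e ω : ℂ) * U ω) ∂P
      = ((∫ ω, (Y e ω) ^ 2 ∂P : ℝ) : ℂ) * ∫ ω, U ω ∂P := by
    have := pc_prod (v := fun x z => (y e x z) ^ 2) hXm hindep ((hy e).pow_const 2) hUfm hUfa hUfb
    rw [← this]
    refine integral_congr_ae (ae_of_all _ fun ω => ?_)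
    simp only [hY, hU, hWe, hUf]; push_cast; ring
  have z4 : ‖(∑ e' ∈ N, ∫ ω, (Y e ω : ℂ) * ((Y e' ω : ℂ) * U ω) ∂P)
      - ((∫ ω, (Y e ω) ^ 2 ∂P : ℝ) : ℂ) * ∫ ω, U ω ∂P‖ ≤ B ^ 2 * (pcM a b e).card := by
    have heN : e ∈ N := by simp [hN, pcN]
    rw [← Finset.add_sum_erase _ _ heN, z3, add_sub_cancel_left]
    calc _ ≤ ∑ e' ∈ N.erase e, ‖∫ ω, (Y e ω : ℂ) * ((Y e' ω : ℂ) * U ω) ∂P‖ := norm_sum_le _ _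
      _ ≤ ∑ e' ∈ N.erase e, if e' ∈ pcM a b e then B ^ 2 else 0 := by
          refine Finset.sum_le_sum fun e' he' => ?_
          split_ifs with h
          · refine (norm_integral_le_of_norm_le_const (C := B ^ 2)
              (ae_of_all _ fun ω => nYYU e' ω)).trans ?_
            simp
          · rw [z2 e' (Finset.ne_of_mem_erase he') h]; simp
      _ ≤ ∑ e', if e' ∈ pcM a b e then B ^ 2 else 0 := by
          refine Finset.sum_le_sum_of_subset_of_nonneg (Finset.subset_univ _) fun _ _ _ => ?_
          split_ifs <;> positivity
      _ = _ := by simp [mul_comm]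
  have intU : Integrable U P := Integrable.of_bound hUm.aestronglyMeasurable 1
      (ae_of_all _ fun ω => (hUn ω).le)
  set V : Ω → ℂ := fun ω => Complex.exp (Complex.I * ((t * ∑ e', Y e' ω : ℝ) : ℂ)) with hV
  have hVm : Measurable V := by
    have : Measurable fun ω => ∑ e', Y e' ω := Finset.measurable_fun_sum _ fun e _ => hYm e
    simp only [hV]; fun_prop
  have intV : Integrable V P := Integrable.of_bound hVm.aestronglyMeasurable 1
      (ae_of_all _ fun ω => (nexp _).le)
  have z5 : ‖(∫ ω, U ω ∂P) - ∫ ω, V ω ∂P‖ ≤ |t| * (D * B) := by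
    rw [← integral_sub intU intV]
    refine (norm_integral_le_of_norm_le_const (C := |t| * (D * B))
      (ae_of_all _ fun ω => ?_)).trans (by simp)
    have : U ω - V ω = - (U ω * (Complex.exp (Complex.I * ((t * R ω : ℝ) : ℂ)) - 1)) := by
      simp only [hV]; rw [hVU]; ring
    rw [this, norm_neg, norm_mul, hUn, one_mul]
    refine Real.norm_exp_I_mul_ofReal_sub_one_le.trans ?_
    rw [Real.norm_eq_abs, abs_mul]; gcongr; exact hRB ω
  have intYUρ : Integrable (fun ω => (Y e ω : ℂ) * U ω * ρ ω) P := by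
    refine Integrable.of_bound (((hYc e).mul hUm).mul hρm).aestronglyMeasurable
      (B * (2 * t ^ 2 * (D * B) ^ 2)) (ae_of_all _ fun ω => ?_)
    rw [norm_mul, norm_mul, hUn, mul_one]
    gcongr
    · exact hYcB e ω
    · exact hρB ω
  have z6 : ‖∫ ω, (Y e ω : ℂ) * U ω * ρ ω ∂P‖ ≤ B * (2 * t ^ 2 * (D * B) ^ 2) := by
    refine (norm_integral_le_of_norm_le_const (C := B * (2 * t ^ 2 * (D * B) ^ 2))
      (ae_of_all _ fun ω => ?_)).trans (by simp)
    rw [norm_mul, norm_mul, hUn, mul_one]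
    gcongr
    · exact hYcB e ω
    · exact hρB ω
  have z7 : ∫ ω, (Y e ω : ℂ) * V ω ∂P =
      Complex.I * t * (∑ e' ∈ N, ∫ ω, (Y e ω : ℂ) * ((Y e' ω : ℂ) * U ω) ∂P)
        + ∫ ω, (Y e ω : ℂ) * U ω * ρ ω ∂P := by
    have h1 : ∀ ω, (Y e ω : ℂ) * V ω = (Y e ω : ℂ) * U ω +
        (Complex.I * t * (∑ e' ∈ N, (Y e ω : ℂ) * ((Y e' ω : ℂ) * U ω)) +
          (Y e ω : ℂ) * U ω * ρ ω) := by
      intro ω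
      have h2 : (∑ e' ∈ N, (Y e ω : ℂ) * ((Y e' ω : ℂ) * U ω)) = (Y e ω : ℂ) * U ω * (R ω : ℂ) := by
        simp only [hR]; push_cast; rw [Finset.mul_sum]
        exact Finset.sum_congr rfl fun _ _ => by ring
      rw [h2]
      simp only [hV]; rw [hVU]
      simp only [hρ]; push_cast; ring
    simp_rw [h1]
    have i1 : Integrable (fun ω => ∑ e' ∈ N, (Y e ω : ℂ) * ((Y e' ω : ℂ) * U ω)) P :=
      integrable_finsetSum _ fun e' _ => intYYU e'
    have i2 : Integrable (fun ω => Complex.I * t * (∑ e' ∈ N, (Y e ω : ℂ) * ((Y e' ω : ℂ) * U ω)) +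
          (Y e ω : ℂ) * U ω * ρ ω) P := (i1.const_mul _).add intYUρ
    rw [integral_add (intYU e) i2, z1, zero_add,
      integral_add (i1.const_mul _) intYUρ, integral_const_mul,
      integral_finsetSum _ fun e' _ => intYYU e']
  have hvar : ‖((∫ ω, (Y e ω) ^ 2 ∂P : ℝ) : ℂ)‖ ≤ B ^ 2 := by
    rw [Complex.norm_real]
    refine (norm_integral_le_of_norm_le_const (C := B ^ 2) (ae_of_all _ fun ω => ?_)).trans (by simp)
    rw [norm_pow, Real.norm_eq_abs]
    have := hYB e ω
    gcongr
  change ‖(∫ ω, (Y e ω : ℂ) * V ω ∂P) - Complex.I * t * ((∫ ω, (Y e ω) ^ 2 ∂P : ℝ) : ℂ) *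
    ∫ ω, V ω ∂P‖ ≤ _
  rw [z7]
  set S := (∑ e' ∈ N, ∫ ω, (Y e ω : ℂ) * ((Y e' ω : ℂ) * U ω) ∂P)
  set q := ((∫ ω, (Y e ω) ^ 2 ∂P : ℝ) : ℂ)
  have h3 : Complex.I * t * S + (∫ ω, (Y e ω : ℂ) * U ω * ρ ω ∂P) - Complex.I * t * q * ∫ ω, V ω ∂P
    = Complex.I * t * (S - q * ∫ ω, U ω ∂P) +
      Complex.I * t * q * ((∫ ω, U ω ∂P) - ∫ ω, V ω ∂P) + ∫ ω, (Y e ω : ℂ) * U ω * ρ ω ∂P := by ring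
  rw [h3]
  have hIt : ‖Complex.I * (t : ℂ)‖ = |t| := by simp
  calc _ ≤ ‖Complex.I * t * (S - q * ∫ ω, U ω ∂P)‖ +
      ‖Complex.I * t * q * ((∫ ω, U ω ∂P) - ∫ ω, V ω ∂P)‖ + ‖∫ ω, (Y e ω : ℂ) * U ω * ρ ω ∂P‖ :=
        norm_add₃_le
    _ ≤ |t| * (B ^ 2 * (pcM a b e).card) + |t| * B ^ 2 * (|t| * (D * B))
        + B * (2 * t ^ 2 * (D * B) ^ 2) := by
      rw [norm_mul, norm_mul (Complex.I * t * q), norm_mul (Complex.I * t), hIt]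
      gcongr
    _ = _ := by rw [← sq_abs t]; ring

lemma pc_clt {Ω E ι : Type*} [MeasurableSpace Ω] [MeasurableSpace E] {P : Measure Ω}
    [IsProbabilityMeasure P] {μ : Measure E} [Fintype ι] [DecidableEq ι]
    {X : ℕ → Ω → E} (hXm : ∀ i, Measurable (X i)) (hindep : iIndepFun X P)
    (hμ : ∀ i, Measure.map (X i) P = μ)
    (a b : ι → ℕ) (hab : ∀ e, a e ≠ b e) (y : ι → E → E → ℝ)
    (hy : ∀ e, Measurable (Function.uncurry (y e)))
    (hy1 : ∀ e, ∀ᵐ x ∂μ, ∫ z, y e z x ∂μ = 0) (hy2 : ∀ e, ∀ᵐ x ∂μ, ∫ z, y e x z ∂μ = 0)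
    (B : ℝ) (hB0 : 0 ≤ B) (hB : ∀ e x z, |y e x z| ≤ B) (D : ℕ) (hD : ∀ e, (pcN a b e).card ≤ D)
    (l : ℝ) (hl : ∑ e, ∫ ω, (y e (X (a e) ω) (X (b e) ω)) ^ 2 ∂P = l) :
    ‖(∫ ω, Complex.exp (Complex.I * ((∑ e', y e' (X (a e') ω) (X (b e') ω) : ℝ) : ℂ)) ∂P)
      - Complex.exp (-(l : ℂ) / 2)‖
      ≤ Fintype.card ι * (2 * D ^ 2 + D) * B ^ 3 + B ^ 2 * ∑ e, ((pcM a b e).card : ℝ) := by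
  set W : Ω → ℝ := fun ω => ∑ e', y e' (X (a e') ω) (X (b e') ω) with hW
  have hYm : ∀ e, Measurable fun ω => y e (X (a e) ω) (X (b e) ω) :=
    fun e => pc_meas2 (hy e) (hXm _) (hXm _)
  have hWm : Measurable W := Finset.measurable_fun_sum _ fun e _ => hYm e
  have hWB : ∀ ω, |W ω| ≤ Fintype.card ι * B := by
    intro ω
    calc |W ω| ≤ ∑ e', |y e' (X (a e') ω) (X (b e') ω)| := Finset.abs_sum_le_sum_abs _ _
      _ ≤ ∑ e' : ι, B := Finset.sum_le_sum fun e' _ => hB _ _ _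
      _ = _ := by simp
  have nexp : ∀ x : ℝ, ‖Complex.exp (Complex.I * (x : ℂ))‖ = 1 := fun x => by
    rw [mul_comm]; exact Complex.norm_exp_ofReal_mul_I x
  obtain ⟨err, herr⟩ : ∃ err : ℝ, err =
    Fintype.card ι * (2 * D ^ 2 + D) * B ^ 3 + B ^ 2 * ∑ e, ((pcM a b e).card : ℝ) := ⟨_, rfl⟩
  rw [← herr]
  have herr0 : 0 ≤ err := by
    rw [herr]
    exact add_nonneg (mul_nonneg (by positivity) (pow_nonneg hB0 3))
      (mul_nonneg (sq_nonneg B) (Finset.sum_nonneg fun _ _ => Nat.cast_nonneg _))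
  set φ : ℝ → ℂ := fun t => ∫ ω, Complex.exp (Complex.I * ((t * W ω : ℝ) : ℂ)) ∂P with hφ
  have hφd : ∀ t : ℝ, HasDerivAt φ
      (∫ ω, Complex.I * (W ω : ℂ) * Complex.exp (Complex.I * ((t * W ω : ℝ) : ℂ)) ∂P) t := by
    intro t
    refine (hasDerivAt_integral_of_dominated_loc_of_deriv_le (𝕜 := ℝ) (μ := P) (s := Set.univ)
      (F := fun (t : ℝ) ω => Complex.exp (Complex.I * ((t * W ω : ℝ) : ℂ)))
      (F' := fun (t : ℝ) ω => Complex.I * (W ω : ℂ) * Complex.exp (Complex.I * ((t * W ω : ℝ) : ℂ)))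
      (x₀ := t) (bound := fun _ => Fintype.card ι * B)
      Filter.univ_mem ?_ ?_ ?_ ?_ (integrable_const (μ := P) _) ?_).2
    · refine Eventually.of_forall fun s => ?_
      exact Measurable.aestronglyMeasurable (by fun_prop)
    · exact Integrable.of_bound (Measurable.aestronglyMeasurable (by fun_prop)) 1
        (ae_of_all _ fun ω => (nexp _).le)
    · exact Measurable.aestronglyMeasurable (by fun_prop)
    · refine ae_of_all _ fun ω s _ => ?_
      rw [norm_mul, nexp, mul_one, norm_mul, Complex.norm_I, one_mul, Complex.norm_real]
      exact hWB ω
    · refine ae_of_all _ fun ω s _ => ?_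
      have h1 : HasDerivAt (fun x : ℝ => Complex.I * ((x * W ω : ℝ) : ℂ)) (Complex.I * (W ω : ℂ)) s := by
        have := (((hasDerivAt_id s).mul_const (W ω)).ofReal_comp).const_mul Complex.I
        simpa using this
      refine h1.cexp.congr_deriv ?_
      ring
  have hφ' : ∀ t : ℝ, |t| ≤ 1 → ‖(∫ ω, Complex.I * (W ω : ℂ) *
      Complex.exp (Complex.I * ((t * W ω : ℝ) : ℂ)) ∂P) + l * t * φ t‖ ≤ err := by
    intro t ht
    have i1 : ∀ e, Integrable (fun ω => (y e (X (a e) ω) (X (b e) ω) : ℂ) *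
        Complex.exp (Complex.I * ((t * W ω : ℝ) : ℂ))) P := by
      intro e
      refine Integrable.of_bound (Measurable.aestronglyMeasurable ?_) B (ae_of_all _ fun ω => ?_)
      · exact (Complex.measurable_ofReal.comp (hYm e)).mul (by fun_prop)
      · rw [norm_mul, nexp, mul_one, Complex.norm_real]; exact hB _ _ _
    have h1 : (∫ ω, Complex.I * (W ω : ℂ) * Complex.exp (Complex.I * ((t * W ω : ℝ) : ℂ)) ∂P)
        = Complex.I * ∑ e, ∫ ω, (y e (X (a e) ω) (X (b e) ω) : ℂ) *
        Complex.exp (Complex.I * ((t * W ω : ℝ) : ℂ)) ∂P := by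
      rw [← integral_finsetSum _ fun e _ => i1 e, ← integral_const_mul]
      refine integral_congr_ae (ae_of_all _ fun ω => ?_)
      simp only
      rw [← Finset.sum_mul]
      have : (∑ e, (y e (X (a e) ω) (X (b e) ω) : ℂ)) = (W ω : ℂ) := by
        simp only [hW]; push_cast; rfl
      rw [this]; ring
    have h2 : (l : ℂ) * t * φ t = Complex.I * ∑ e, - (Complex.I * t *
        ((∫ ω, (y e (X (a e) ω) (X (b e) ω)) ^ 2 ∂P : ℝ) : ℂ) * φ t) := by
      rw [Finset.sum_neg_distrib, ← Finset.sum_mul, ← Finset.mul_sum, ← hl]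
      push_cast
      linear_combination ((∑ e, ((∫ ω, (y e (X (a e) ω) (X (b e) ω)) ^ 2 ∂P : ℝ) : ℂ)) * t * φ t) * Complex.I_sq
    rw [h1, h2, ← mul_add, ← Finset.sum_add_distrib, norm_mul, Complex.norm_I, one_mul]
    calc _ ≤ ∑ e, (2 * t ^ 2 * D ^ 2 * B ^ 3 + |t| * B ^ 2 * (pcM a b e).card + t ^ 2 * D * B ^ 3) := by
          refine (norm_sum_le _ _).trans (Finset.sum_le_sum fun e _ => ?_)
          rw [← sub_eq_add_neg]
          exact pc_edge hXm hindep hμ a b hab y hy hy1 hy2 B hB D hD t e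
      _ ≤ ∑ e, (2 * 1 * D ^ 2 * B ^ 3 + 1 * B ^ 2 * (pcM a b e).card + 1 * D * B ^ 3) := by
          have : t ^ 2 ≤ 1 := by rw [← sq_abs]; exact pow_le_one₀ (abs_nonneg _) ht
          gcongr
      _ = err := by
          rw [herr]
          simp only [Finset.sum_add_distrib, Finset.sum_const, Finset.card_univ, nsmul_eq_mul,
            ← Finset.mul_sum]
          ring
  -- integrate
  have hl0 : 0 ≤ l := by
    rw [← hl]; exact Finset.sum_nonneg fun e _ => integral_nonneg fun ω => sq_nonneg _
  set F : ℝ → ℂ := fun t => φ t * Complex.exp ((l * t ^ 2 / 2 : ℝ) : ℂ) with hF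
  have hFd : ∀ t : ℝ, HasDerivAt F (((∫ ω, Complex.I * (W ω : ℂ) *
      Complex.exp (Complex.I * ((t * W ω : ℝ) : ℂ)) ∂P) + l * t * φ t) *
      Complex.exp ((l * t ^ 2 / 2 : ℝ) : ℂ)) t := by
    intro t
    have h1 : HasDerivAt (fun t : ℝ => ((l * t ^ 2 / 2 : ℝ) : ℂ)) ((l * t : ℝ) : ℂ) t := by
      have h0 : HasDerivAt (fun t : ℝ => l * t ^ 2 / 2) (l * t) t := by
        refine (((hasDerivAt_pow 2 t).const_mul l).div_const 2).congr_deriv ?_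
        simp; ring
      exact h0.ofReal_comp
    have h2 := (hφd t).mul h1.cexp
    refine h2.congr_deriv ?_
    push_cast; ring
  have key := norm_image_sub_le_of_norm_deriv_le_segment_01' (f := F) (C := err * Real.exp (l / 2))
    (fun t _ => (hFd t).hasDerivWithinAt) (by
      intro t ht
      rw [norm_mul]
      have ht1 : |t| ≤ 1 := by rw [abs_of_nonneg ht.1]; exact ht.2.le
      refine mul_le_mul (hφ' t ht1) ?_ (norm_nonneg _) herr0
      rw [Complex.norm_exp_ofReal]
      refine Real.exp_le_exp.2 ?_
      have : t ^ 2 ≤ 1 := by rw [← sq_abs]; exact pow_le_one₀ (abs_nonneg _) ht1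
      nlinarith)
  have hF0 : F 0 = 1 := by simp [hF, hφ]
  have hF1 : F 1 = (∫ ω, Complex.exp (Complex.I * (W ω : ℂ)) ∂P) * Complex.exp ((l / 2 : ℝ) : ℂ) := by
    simp [hF, hφ]
  rw [hF0, hF1] at key
  have hfin : (∫ ω, Complex.exp (Complex.I * (W ω : ℂ)) ∂P) - Complex.exp (-(l : ℂ) / 2)
     = ((∫ ω, Complex.exp (Complex.I * (W ω : ℂ)) ∂P) * Complex.exp ((l / 2 : ℝ) : ℂ) - 1) *
      Complex.exp ((-(l / 2) : ℝ) : ℂ) := by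
    rw [sub_mul, mul_assoc, ← Complex.exp_add]
    have : ((l / 2 : ℝ) : ℂ) + ((-(l / 2) : ℝ) : ℂ) = 0 := by push_cast; ring
    rw [this, Complex.exp_zero, mul_one, one_mul]
    congr 2; push_cast; ring
  rw [hfin, norm_mul, Complex.norm_exp_ofReal]
  calc _ ≤ err * Real.exp (l / 2) * Real.exp (-(l / 2)) := by gcongr
    _ = err := by rw [mul_assoc, ← Real.exp_add]; simp



lemma pcN_card {ι : Type*} [Fintype ι] [DecidableEq ι] (a b : ι → ℕ) (k : ℕ)
    (ha : ∀ m, (univ.filter fun e => a e = m).card ≤ k)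
    (hb : ∀ m, (univ.filter fun e => b e = m).card ≤ k) (e : ι) : (pcN a b e).card ≤ 4 * k := by
  have : pcN a b e ⊆ (univ.filter fun e' => a e' = a e) ∪ (univ.filter fun e' => a e' = b e) ∪
      (univ.filter fun e' => b e' = a e) ∪ (univ.filter fun e' => b e' = b e) := by
    intro x hx
    simp only [pcN, mem_filter, mem_univ, true_and, mem_union] at *
    tauto
  refine (card_le_card this).trans ?_
  have h1 := card_union_le (filter (fun e' => a e' = a e) univ ∪ filter (fun e' => a e' = b e) univ ∪
    filter (fun e' => b e' = a e) univ) (filter (fun e' => b e' = b e) univ)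
  have h2 := card_union_le (filter (fun e' => a e' = a e) univ ∪ filter (fun e' => a e' = b e) univ)
    (filter (fun e' => b e' = a e) univ)
  have h3 := card_union_le (filter (fun e' => a e' = a e) univ) (filter (fun e' => a e' = b e) univ)
  have := ha (a e); have := ha (b e); have := hb (a e); have := hb (b e)
  omega

lemma pc_fiber_one {n : ℕ} (f : Fin n → Fin n) (hf : Function.Injective f) (m : ℕ) :
    (univ.filter fun i => (f i : ℕ) = m).card ≤ 1 := by
  rw [card_le_one]
  intro x hx y hy
  simp only [mem_filter, mem_univ, true_and] at hx hy
  exact hf (Fin.ext (hx.trans hy.symm))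

lemma pc_fiber_two {n : ℕ} (f g : Fin n → Fin n) (hf : Function.Injective f)
    (hg : Function.Injective g) (m : ℕ) :
    (univ.filter fun e => Sum.elim (fun i => (f i : ℕ)) (fun i => (g i : ℕ)) e = m).card ≤ 2 := by
  have e1 : (univ.filter fun e => Sum.elim (fun i => (f i : ℕ)) (fun i => (g i : ℕ)) e = m)
    = (univ.filter fun i => (f i : ℕ) = m).disjSum (univ.filter fun i => (g i : ℕ) = m) := by
    ext x; cases x <;> simp
  rw [e1, card_disjSum]
  have := pc_fiber_one f hf m; have := pc_fiber_one g hg m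
  omega

lemma pc_rot1 {n : ℕ} (hn : 3 ≤ n) (i : Fin n) : finRotate n i ≠ i := by
  obtain ⟨m, rfl⟩ : ∃ m, n = m + 3 := ⟨n - 3, by omega⟩
  rw [finRotate_succ_apply]
  simp

lemma pc_rot2 {n : ℕ} (hn : 3 ≤ n) (i : Fin n) : finRotate n (finRotate n i) ≠ i := by
  obtain ⟨m, rfl⟩ : ∃ m, n = m + 3 := ⟨n - 3, by omega⟩
  rw [finRotate_succ_apply, finRotate_succ_apply]
  rw [add_assoc]
  intro h
  have h2 : (1 + 1 : Fin (m + 3)) = 0 := by simpa using h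
  have := congrArg Fin.val h2
  simp [Fin.val_add] at this
  rw [Nat.mod_eq_of_lt (by omega)] at this
  omega

lemma pc_count {n : ℕ} (j k u v : Fin n) (huv : u ≠ v) (hjk : j ≠ k) :
    (univ.filter fun π : Equiv.Perm (Fin n) => π j = u ∧ π k = v).card * (n * (n - 1))
      ≤ n.factorial := by
  have step1 : ∀ w, u ≠ w → (univ.filter fun π : Equiv.Perm (Fin n) => π j = u ∧ π k = v).card
      ≤ (univ.filter fun π : Equiv.Perm (Fin n) => π j = u ∧ π k = w).card := by
    intro w hw
    refine card_le_card_of_injOn (fun π => Equiv.swap v w * π) ?_ ?_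
    · intro π hπ
      simp only [coe_filter, mem_univ, true_and, Set.mem_setOf_eq] at hπ ⊢
      simp [hπ.1, hπ.2, Equiv.swap_apply_of_ne_of_ne huv hw]
    · intro x _ y _ h; exact mul_left_cancel h
  have step2 : ∀ w, (univ.filter fun π : Equiv.Perm (Fin n) => π j = u).card
      ≤ (univ.filter fun π : Equiv.Perm (Fin n) => π j = w).card := by
    intro w
    refine card_le_card_of_injOn (fun π => Equiv.swap u w * π) ?_ ?_
    · intro π hπ
      simp only [coe_filter, mem_univ, true_and, Set.mem_setOf_eq] at hπ ⊢
      simp [hπ]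
    · intro x _ y _ h; exact mul_left_cancel h
  have s1 : (univ.filter fun π : Equiv.Perm (Fin n) => π j = u ∧ π k = v).card * (n - 1) ≤
      (univ.filter fun π : Equiv.Perm (Fin n) => π j = u).card := by
    have h := card_eq_sum_card_fiberwise (f := fun π : Equiv.Perm (Fin n) => π k)
      (s := univ.filter fun π : Equiv.Perm (Fin n) => π j = u) (t := univ.erase u) (by
        intro π hπ
        simp only [coe_filter, mem_univ, true_and, Set.mem_setOf_eq] at hπ
        simp only [coe_erase, coe_univ, Set.mem_diff, Set.mem_univ, true_and, Set.mem_singleton_iff]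
        intro h; exact hjk (π.injective (hπ.trans h.symm)))
    rw [h]
    calc _ = ∑ w ∈ univ.erase u,
          (univ.filter fun π : Equiv.Perm (Fin n) => π j = u ∧ π k = v).card := by
          simp [card_erase_of_mem, mul_comm]
      _ ≤ _ := by
          refine sum_le_sum fun w hw => ?_
          rw [filter_filter]
          exact step1 w (ne_of_mem_erase hw).symm
  have s2 : (univ.filter fun π : Equiv.Perm (Fin n) => π j = u).card * n ≤ n.factorial := by
    have h := card_eq_sum_card_fiberwise (f := fun π : Equiv.Perm (Fin n) => π j)
      (s := univ) (t := univ) (by intro π _; simp)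
    rw [card_univ, Fintype.card_perm, Fintype.card_fin] at h
    rw [h]
    calc _ = ∑ w : Fin n, (univ.filter fun π : Equiv.Perm (Fin n) => π j = u).card := by
          simp [mul_comm]
      _ ≤ _ := sum_le_sum fun w _ => step2 w
  calc _ = (univ.filter fun π : Equiv.Perm (Fin n) => π j = u ∧ π k = v).card * (n - 1) * n := by ring
    _ ≤ _ := (Nat.mul_le_mul_right n s1).trans s2

def pcA {n : ℕ} (π : Equiv.Perm (Fin n)) (i : Fin n) : ℕ := (π i : ℕ)
def pcB {n : ℕ} (π : Equiv.Perm (Fin n)) (i : Fin n) : ℕ := (π (finRotate n i) : ℕ)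

lemma pcAB_ne {n : ℕ} (hn : 3 ≤ n) (π : Equiv.Perm (Fin n)) (i : Fin n) : pcA π i ≠ pcB π i := by
  intro h
  exact pc_rot1 hn i (π.injective (Fin.ext h)).symm

lemma pcM_one {n : ℕ} (hn : 3 ≤ n) (π : Equiv.Perm (Fin n)) (i : Fin n) :
    pcM (pcA π) (pcB π) i = ∅ := by
  rw [pcM, filter_eq_empty_iff]
  rintro j - ⟨hne, ⟨h1, -⟩ | ⟨h1, h2⟩⟩
  · exact hne (π.injective (Fin.ext h1))
  · have e1 : j = finRotate n i := π.injective (Fin.ext h1)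
    have e2 : finRotate n j = i := π.injective (Fin.ext h2)
    rw [e1] at e2
    exact pc_rot2 hn i e2

lemma pcM_two_aux {n : ℕ} (hn : 3 ≤ n) (π π' : Equiv.Perm (Fin n)) :
    ∑ e, (pcM (Sum.elim (pcA π) (pcA π')) (Sum.elim (pcB π) (pcB π')) e).card
      ≤ 2 * ∑ i, ∑ j, ((if π' j = π i ∧ π' (finRotate n j) = π (finRotate n i) then 1 else 0)
        + if π' (finRotate n j) = π i ∧ π' j = π (finRotate n i) then 1 else 0) := by
  rw [Fintype.sum_sum_type, two_mul]
  refine add_le_add ?_ ?_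
  · refine sum_le_sum fun i _ => ?_
    rw [pcM, card_filter, Fintype.sum_sum_type]
    have : ∑ j, (if Sum.inl j ≠ (Sum.inl i : Fin n ⊕ Fin n) ∧
      ((Sum.elim (pcA π) (pcA π') (Sum.inl j) = Sum.elim (pcA π) (pcA π') (Sum.inl i) ∧
        Sum.elim (pcB π) (pcB π') (Sum.inl j) = Sum.elim (pcB π) (pcB π') (Sum.inl i)) ∨
       (Sum.elim (pcA π) (pcA π') (Sum.inl j) = Sum.elim (pcB π) (pcB π') (Sum.inl i) ∧
        Sum.elim (pcB π) (pcB π') (Sum.inl j) = Sum.elim (pcA π) (pcA π') (Sum.inl i))) then 1 else 0)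
        = (pcM (pcA π) (pcB π) i).card := by
      rw [pcM, card_filter]; simp
    rw [this, pcM_one hn, card_empty, zero_add]
    refine sum_le_sum fun j _ => ?_
    simp only [Sum.elim_inl, Sum.elim_inr, pcA, pcB, Fin.val_inj]
    grind
  · rw [sum_comm]
    refine sum_le_sum fun i _ => ?_
    rw [pcM, card_filter, Fintype.sum_sum_type]
    have : ∑ j, (if Sum.inr j ≠ (Sum.inr i : Fin n ⊕ Fin n) ∧
      ((Sum.elim (pcA π) (pcA π') (Sum.inr j) = Sum.elim (pcA π) (pcA π') (Sum.inr i) ∧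
        Sum.elim (pcB π) (pcB π') (Sum.inr j) = Sum.elim (pcB π) (pcB π') (Sum.inr i)) ∨
       (Sum.elim (pcA π) (pcA π') (Sum.inr j) = Sum.elim (pcB π) (pcB π') (Sum.inr i) ∧
        Sum.elim (pcB π) (pcB π') (Sum.inr j) = Sum.elim (pcA π) (pcA π') (Sum.inr i))) then 1 else 0)
        = (pcM (pcA π') (pcB π') i).card := by
      rw [pcM, card_filter]; simp
    rw [this, pcM_one hn, card_empty, add_zero]
    refine sum_le_sum fun j _ => ?_
    simp only [Sum.elim_inl, Sum.elim_inr, pcA, pcB, Fin.val_inj]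
    grind

lemma pcM_two {n : ℕ} (hn : 3 ≤ n) (π : Equiv.Perm (Fin n)) :
    ∑ π' : Equiv.Perm (Fin n),
      ∑ e, (pcM (Sum.elim (pcA π) (pcA π')) (Sum.elim (pcB π) (pcB π')) e).card
      ≤ 8 * n.factorial := by
  have h1 : ∑ π' : Equiv.Perm (Fin n),
      ∑ e, (pcM (Sum.elim (pcA π) (pcA π')) (Sum.elim (pcB π) (pcB π')) e).card ≤
      2 * ∑ i, ∑ j, ((univ.filter fun π' : Equiv.Perm (Fin n) =>
          π' j = π i ∧ π' (finRotate n j) = π (finRotate n i)).card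
        + (univ.filter fun π' : Equiv.Perm (Fin n) =>
          π' (finRotate n j) = π i ∧ π' j = π (finRotate n i)).card) := by
    refine (sum_le_sum fun π' _ => pcM_two_aux hn π π').trans ?_
    rw [← mul_sum, sum_comm]
    refine Nat.mul_le_mul_left 2 (sum_le_sum fun i _ => ?_)
    rw [sum_comm]
    refine sum_le_sum fun j _ => ?_
    rw [sum_add_distrib, card_filter, card_filter]
  have hpos : 0 < n * (n - 1) := Nat.mul_pos (by omega) (by omega)
  refine le_of_mul_le_mul_right (a := n * (n - 1)) ?_ hpos
  refine (Nat.mul_le_mul_right _ h1).trans ?_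
  rw [mul_assoc, sum_mul]
  have h2 : ∀ i : Fin n, (∑ j, ((univ.filter fun π' : Equiv.Perm (Fin n) =>
          π' j = π i ∧ π' (finRotate n j) = π (finRotate n i)).card
        + (univ.filter fun π' : Equiv.Perm (Fin n) =>
          π' (finRotate n j) = π i ∧ π' j = π (finRotate n i)).card)) * (n * (n - 1))
          ≤ n * (2 * n.factorial) := by
    intro i
    rw [sum_mul]
    calc _ ≤ ∑ j : Fin n, 2 * n.factorial := by
          refine sum_le_sum fun j _ => ?_
          rw [add_mul, two_mul]
          have hne : π i ≠ π (finRotate n i) := fun h => pc_rot1 hn i (π.injective h).symm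
          exact add_le_add (pc_count _ _ _ _ hne (pc_rot1 hn j).symm)
            (pc_count _ _ _ _ hne (pc_rot1 hn j))
      _ = _ := by simp
  calc _ ≤ 2 * ∑ i : Fin n, n * (2 * n.factorial) := Nat.mul_le_mul_left 2 (sum_le_sum fun i _ => h2 i)
    _ = 4 * n.factorial * (n * n) := by simp; ring
    _ ≤ 4 * n.factorial * (2 * (n * (n - 1))) := by
        refine Nat.mul_le_mul_left _ ?_
        obtain ⟨m, rfl⟩ : ∃ m, n = m + 3 := ⟨n - 3, by omega⟩
        have : m + 3 - 1 = m + 2 := by omega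
        rw [this]; nlinarith
    _ = _ := by ring


lemma pc_joint {Ω E : Type*} [MeasurableSpace Ω] [MeasurableSpace E] {P : Measure Ω}
    [IsProbabilityMeasure P] {μ : Measure E}
    {X : ℕ → Ω → E} (hXm : ∀ i, Measurable (X i)) (hindep : iIndepFun X P)
    (hμ : ∀ i, Measure.map (X i) P = μ) {a b : ℕ} (hab : a ≠ b) :
    Measure.map (fun ω => (X a ω, X b ω)) P = μ.prod μ := by
  have h := (indepFun_iff_map_prod_eq_prod_map_map (hXm a).aemeasurable
    (hXm b).aemeasurable).1 (hindep.indepFun hab)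
  rw [h, hμ a, hμ b]

def pcW {Ω E : Type*} (X : ℕ → Ω → E) (n : ℕ) (g : E → E → ℝ) (π : Equiv.Perm (Fin n)) (ω : Ω) : ℝ :=
  ∑ i, (Real.sqrt n)⁻¹ * g (X (pcA π i) ω) (X (pcB π i) ω)

def pcPhi {Ω E : Type*} (X : ℕ → Ω → E) (n : ℕ) (g : E → E → ℝ) (ω : Ω) : ℂ :=
  (n.factorial : ℂ)⁻¹ * ∑ π : Equiv.Perm (Fin n), Complex.exp (Complex.I * (pcW X n g π ω : ℂ))

lemma pcW_meas {Ω E : Type*} [MeasurableSpace Ω] [MeasurableSpace E]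
    {X : ℕ → Ω → E} (hXm : ∀ i, Measurable (X i)) (n : ℕ) {g : E → E → ℝ}
    (hg : Measurable (Function.uncurry g)) (π : Equiv.Perm (Fin n)) : Measurable (pcW X n g π) := by
  unfold pcW
  refine Finset.measurable_sum _ fun i _ => ?_
  exact (pc_meas2 hg (hXm _) (hXm _)).const_mul _

lemma pc_expint {Ω : Type*} [MeasurableSpace Ω] {P : Measure Ω} [IsProbabilityMeasure P]
    {W : Ω → ℝ} (hW : Measurable W) : Integrable (fun ω => Complex.exp (Complex.I * (W ω : ℂ))) P := by
  refine Integrable.of_bound (C := 1) ?_ (ae_of_all _ fun ω => ?_)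
  · exact Measurable.aestronglyMeasurable (by fun_prop)
  · rw [mul_comm, Complex.norm_exp_ofReal_mul_I]

lemma pc_second {Ω S : Type*} [MeasurableSpace Ω] {P : Measure Ω} [IsProbabilityMeasure P]
    [Fintype S] {W : S → Ω → ℝ} (hW : ∀ s, Measurable (W s)) (c : ℝ) (hc0 : 0 ≤ c) (hc1 : c ≤ 1) :
    ∫ ω, ‖∑ s, (Complex.exp (Complex.I * (W s ω : ℂ)) - c)‖ ^ 2 ∂P ≤
    ∑ s, ∑ s', (‖(∫ ω, Complex.exp (Complex.I * ((W s ω - W s' ω : ℝ) : ℂ)) ∂P) - (c : ℂ) ^ 2‖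
      + ‖(∫ ω, Complex.exp (Complex.I * (W s ω : ℂ)) ∂P) - c‖
      + ‖(∫ ω, Complex.exp (Complex.I * (W s' ω : ℂ)) ∂P) - c‖) := by
  have i1 : ∀ s, Integrable (fun ω => Complex.exp (Complex.I * (W s ω : ℂ))) P :=
    fun s => pc_expint (hW s)
  have i1c : ∀ s, Integrable (fun ω => (starRingEnd ℂ) (Complex.exp (Complex.I * (W s ω : ℂ)))) P := by
    intro s
    have := pc_expint (P := P) (hW s).neg
    refine this.congr (ae_of_all _ fun ω => ?_)
    simp [← Complex.exp_conj]
  have i2 : ∀ s s', Integrable (fun ω => Complex.exp (Complex.I * ((W s ω - W s' ω : ℝ) : ℂ))) P :=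
    fun s s' => pc_expint ((hW s).sub (hW s'))
  set F : S → S → Ω → ℂ := fun s s' ω =>
    (Complex.exp (Complex.I * ((W s ω - W s' ω : ℝ) : ℂ)) - (c : ℂ) ^ 2)
      - (c : ℂ) * (Complex.exp (Complex.I * (W s ω : ℂ)) - c)
      - (c : ℂ) * ((starRingEnd ℂ) (Complex.exp (Complex.I * (W s' ω : ℂ))) - c) with hF
  have iF : ∀ s s', Integrable (F s s') P := by
    intro s s'
    exact (((i2 s s').sub (integrable_const _)).sub (((i1 s).sub (integrable_const _)).const_mul _)).sub
      (((i1c s').sub (integrable_const _)).const_mul _)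
  have key : ∀ ω, ((‖∑ s, (Complex.exp (Complex.I * (W s ω : ℂ)) - c)‖ ^ 2 : ℝ) : ℂ)
      = ∑ s, ∑ s', F s s' ω := by
    intro ω
    push_cast
    rw [← Complex.mul_conj', map_sum, sum_mul_sum]
    refine sum_congr rfl fun s _ => sum_congr rfl fun s' _ => ?_
    have : Complex.exp (Complex.I * ((W s ω - W s' ω : ℝ) : ℂ)) =
      Complex.exp (Complex.I * (W s ω : ℂ)) * (starRingEnd ℂ) (Complex.exp (Complex.I * (W s' ω : ℂ))) := by
      rw [← Complex.exp_conj, ← Complex.exp_add]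
      congr 1; simp; ring
    simp only [hF, this, map_sub, Complex.conj_ofReal]
    ring
  have h1 : ((∫ ω, ‖∑ s, (Complex.exp (Complex.I * (W s ω : ℂ)) - c)‖ ^ 2 ∂P : ℝ) : ℂ)
      = ∑ s, ∑ s', ∫ ω, F s s' ω ∂P := by
    rw [← integral_complex_ofReal]
    simp_rw [key]
    rw [integral_finsetSum _ (fun s _ => integrable_finsetSum _ fun s' _ => iF s s')]
    refine sum_congr rfl fun s _ => ?_
    rw [integral_finsetSum _ (fun s' _ => iF s s')]
  have hnn : 0 ≤ ∫ ω, ‖∑ s, (Complex.exp (Complex.I * (W s ω : ℂ)) - c)‖ ^ 2 ∂P :=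
    integral_nonneg fun ω => by positivity
  have h2 : ∫ ω, ‖∑ s, (Complex.exp (Complex.I * (W s ω : ℂ)) - c)‖ ^ 2 ∂P
      = ‖∑ s, ∑ s', ∫ ω, F s s' ω ∂P‖ := by
    rw [← h1, Complex.norm_real, Real.norm_of_nonneg hnn]
  rw [h2]
  refine (norm_sum_le _ _).trans (sum_le_sum fun s _ => (norm_sum_le _ _).trans
    (sum_le_sum fun s' _ => ?_))
  have h3 : ∫ ω, F s s' ω ∂P =
     ((∫ ω, Complex.exp (Complex.I * ((W s ω - W s' ω : ℝ) : ℂ)) ∂P) - (c : ℂ) ^ 2)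
      - (c : ℂ) * ((∫ ω, Complex.exp (Complex.I * (W s ω : ℂ)) ∂P) - c)
      - (c : ℂ) * (starRingEnd ℂ) ((∫ ω, Complex.exp (Complex.I * (W s' ω : ℂ)) ∂P) - c) := by
    simp only [hF]
    rw [integral_sub, integral_sub, integral_sub (i2 s s') (integrable_const _), integral_const_mul,
      integral_const_mul, integral_sub (i1 s) (integrable_const _),
      integral_sub (i1c s') (integrable_const _), integral_conj]
    · simp
    · exact (i2 s s').sub (integrable_const _)
    · exact ((i1 s).sub (integrable_const _)).const_mul _
    · exact ((i2 s s').sub (integrable_const _)).sub (((i1 s).sub (integrable_const _)).const_mul _)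
    · exact ((i1c s').sub (integrable_const _)).const_mul _
  rw [h3]
  refine (norm_sub_le _ _).trans (add_le_add ((norm_sub_le _ _).trans (add_le_add le_rfl ?_)) ?_)
  · rw [norm_mul, Complex.norm_real, Real.norm_of_nonneg hc0]
    exact mul_le_of_le_one_left (norm_nonneg _) hc1
  · rw [norm_mul, Complex.norm_real, Real.norm_of_nonneg hc0, RCLike.norm_conj]
    exact mul_le_of_le_one_left (norm_nonneg _) hc1

lemma pc_T1 {Ω E : Type*} [MeasurableSpace Ω] [MeasurableSpace E] {P : Measure Ω}
    [IsProbabilityMeasure P] {μ : Measure E}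
    {X : ℕ → Ω → E} (hXm : ∀ i, Measurable (X i)) (hindep : iIndepFun X P)
    (hμ : ∀ i, Measure.map (X i) P = μ) {g : E → E → ℝ} (hg : Measurable (Function.uncurry g))
    (hg1 : ∀ᵐ x ∂μ, ∫ z, g z x ∂μ = 0) (hg2 : ∀ᵐ x ∂μ, ∫ z, g x z ∂μ = 0)
    {K : ℝ} (hK0 : 0 ≤ K) (hK : ∀ x z, |g x z| ≤ K) {n : ℕ} (hn : 3 ≤ n) (π : Equiv.Perm (Fin n)) :
    ‖(∫ ω, Complex.exp (Complex.I * (pcW X n g π ω : ℂ)) ∂P)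
      - Complex.exp (-((∫ p, g p.1 p.2 ^ 2 ∂(μ.prod μ) : ℝ) : ℂ) / 2)‖
      ≤ n * (2 * 4 ^ 2 + 4) * ((Real.sqrt n)⁻¹ * K) ^ 3 := by
  have hn0 : (0 : ℝ) < n := by exact_mod_cast (by omega : 0 < n)
  have h := pc_clt hXm hindep hμ (pcA π) (pcB π) (pcAB_ne hn π)
    (fun _ x z => (Real.sqrt n)⁻¹ * g x z) (fun _ => hg.const_mul _)
    (fun _ => by filter_upwards [hg1] with x hx; rw [integral_const_mul, hx, mul_zero])
    (fun _ => by filter_upwards [hg2] with x hx; rw [integral_const_mul, hx, mul_zero])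
    ((Real.sqrt n)⁻¹ * K) (by positivity)
    (fun _ x z => by
      rw [abs_mul, abs_of_nonneg (by positivity : 0 ≤ (Real.sqrt n)⁻¹)]
      exact mul_le_mul_of_nonneg_left (hK x z) (by positivity)) 4
    (fun e => pcN_card _ _ 1 (pc_fiber_one _ π.injective)
      (pc_fiber_one (fun i => π (finRotate n i)) (π.injective.comp (finRotate n).injective)) e)
    (∫ p, g p.1 p.2 ^ 2 ∂(μ.prod μ)) (by
      have : ∀ e : Fin n, ∫ ω, ((Real.sqrt n)⁻¹ * g (X (pcA π e) ω) (X (pcB π e) ω)) ^ 2 ∂P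
          = (n : ℝ)⁻¹ * ∫ p, g p.1 p.2 ^ 2 ∂(μ.prod μ) := by
        intro e
        rw [← pc_joint hXm hindep hμ (pcAB_ne hn π e), integral_map]
        · rw [← integral_const_mul]
          simp_rw [mul_pow, inv_pow, Real.sq_sqrt hn0.le]
        · exact ((hXm _).prodMk (hXm _)).aemeasurable
        · exact ((pc_meas2 hg measurable_fst measurable_snd).pow_const 2).aestronglyMeasurable
      rw [sum_congr rfl fun e _ => this e]
      simp [hn0.ne'])
  have hM : ∀ e, ((pcM (pcA π) (pcB π) e).card : ℝ) = 0 := fun e => by rw [pcM_one hn]; simp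
  simp only [hM, sum_const_zero, mul_zero, add_zero, Fintype.card_fin] at h
  exact_mod_cast h

lemma pc_T2 {Ω E : Type*} [MeasurableSpace Ω] [MeasurableSpace E] {P : Measure Ω}
    [IsProbabilityMeasure P] {μ : Measure E}
    {X : ℕ → Ω → E} (hXm : ∀ i, Measurable (X i)) (hindep : iIndepFun X P)
    (hμ : ∀ i, Measure.map (X i) P = μ) {g : E → E → ℝ} (hg : Measurable (Function.uncurry g))
    (hg1 : ∀ᵐ x ∂μ, ∫ z, g z x ∂μ = 0) (hg2 : ∀ᵐ x ∂μ, ∫ z, g x z ∂μ = 0)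
    {K : ℝ} (hK0 : 0 ≤ K) (hK : ∀ x z, |g x z| ≤ K) {n : ℕ} (hn : 3 ≤ n) (π π' : Equiv.Perm (Fin n)) :
    ‖(∫ ω, Complex.exp (Complex.I * ((pcW X n g π ω - pcW X n g π' ω : ℝ) : ℂ)) ∂P)
      - Complex.exp (-((2 * ∫ p, g p.1 p.2 ^ 2 ∂(μ.prod μ) : ℝ) : ℂ) / 2)‖
      ≤ (n + n) * (2 * 8 ^ 2 + 8) * ((Real.sqrt n)⁻¹ * K) ^ 3 + ((Real.sqrt n)⁻¹ * K) ^ 2 *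
        ∑ e, ((pcM (Sum.elim (pcA π) (pcA π')) (Sum.elim (pcB π) (pcB π')) e).card : ℝ) := by
  have hn0 : (0 : ℝ) < n := by exact_mod_cast (by omega : 0 < n)
  set s : Fin n ⊕ Fin n → ℝ := Sum.elim (fun _ => (Real.sqrt n)⁻¹) (fun _ => -(Real.sqrt n)⁻¹) with hs
  have hs2 : ∀ e, s e ^ 2 = (n : ℝ)⁻¹ := by
    rintro (e | e) <;> simp [hs, inv_pow, Real.sq_sqrt hn0.le]
  have hsa : ∀ e, |s e| = (Real.sqrt n)⁻¹ := by
    rintro (e | e) <;> simp [hs]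
  have hne : ∀ e, Sum.elim (pcA π) (pcA π') e ≠ Sum.elim (pcB π) (pcB π') e := by
    rintro (e | e)
    · exact pcAB_ne hn π e
    · exact pcAB_ne hn π' e
  have h := pc_clt hXm hindep hμ (Sum.elim (pcA π) (pcA π')) (Sum.elim (pcB π) (pcB π')) hne
    (fun e x z => s e * g x z) (fun _ => hg.const_mul _)
    (fun _ => by filter_upwards [hg1] with x hx; rw [integral_const_mul, hx, mul_zero])
    (fun _ => by filter_upwards [hg2] with x hx; rw [integral_const_mul, hx, mul_zero])
    ((Real.sqrt n)⁻¹ * K) (by positivity)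
    (fun e x z => by
      rw [abs_mul, hsa]
      exact mul_le_mul_of_nonneg_left (hK x z) (by positivity)) 8
    (fun e => pcN_card _ _ 2 (pc_fiber_two _ _ π.injective π'.injective)
      (pc_fiber_two (fun i => π (finRotate n i)) (fun i => π' (finRotate n i))
        (π.injective.comp (finRotate n).injective) (π'.injective.comp (finRotate n).injective)) e)
    (2 * ∫ p, g p.1 p.2 ^ 2 ∂(μ.prod μ)) (by
      have : ∀ e, ∫ ω, (s e * g (X (Sum.elim (pcA π) (pcA π') e) ω)
          (X (Sum.elim (pcB π) (pcB π') e) ω)) ^ 2 ∂P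
          = (n : ℝ)⁻¹ * ∫ p, g p.1 p.2 ^ 2 ∂(μ.prod μ) := by
        intro e
        rw [← pc_joint hXm hindep hμ (hne e), integral_map]
        · rw [← integral_const_mul]
          simp_rw [mul_pow, hs2]
        · exact ((hXm _).prodMk (hXm _)).aemeasurable
        · exact ((pc_meas2 hg measurable_fst measurable_snd).pow_const 2).aestronglyMeasurable
      rw [sum_congr rfl fun e _ => this e]
      simp only [sum_const, card_univ, Fintype.card_sum, Fintype.card_fin, nsmul_eq_mul]
      push_cast
      field_simp
      ring)
  have hW : ∀ ω, ∑ e', s e' * g (X (Sum.elim (pcA π) (pcA π') e') ω) (X (Sum.elim (pcB π) (pcB π') e') ω)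
      = pcW X n g π ω - pcW X n g π' ω := by
    intro ω
    rw [Fintype.sum_sum_type]
    simp [hs, pcW, sub_eq_add_neg]
  simp only [hW, Fintype.card_sum, Fintype.card_fin] at h
  push_cast at h ⊢
  exact h

lemma pc_bdd {Ω E : Type*} [MeasurableSpace Ω] [MeasurableSpace E] {P : Measure Ω}
    [IsProbabilityMeasure P] {μ : Measure E}
    {X : ℕ → Ω → E} (hXm : ∀ i, Measurable (X i)) (hindep : iIndepFun X P)
    (hμ : ∀ i, Measure.map (X i) P = μ) {g : E → E → ℝ} (hg : Measurable (Function.uncurry g))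
    (hg1 : ∀ᵐ x ∂μ, ∫ z, g z x ∂μ = 0) (hg2 : ∀ᵐ x ∂μ, ∫ z, g x z ∂μ = 0)
    {K : ℝ} (hK0 : 0 ≤ K) (hK : ∀ x z, |g x z| ≤ K) {n : ℕ} (hn : 3 ≤ n) :
    ∫ ω, ‖pcPhi X n g ω - (Real.exp (-(∫ p, g p.1 p.2 ^ 2 ∂(μ.prod μ)) / 2) : ℝ)‖ ^ 2 ∂P
      ≤ 344 * (n * ((Real.sqrt n)⁻¹ * K) ^ 3) + 8 * ((Real.sqrt n)⁻¹ * K) ^ 2 := by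
  set v : ℝ := ∫ p, g p.1 p.2 ^ 2 ∂(μ.prod μ) with hv
  have hv0 : 0 ≤ v := integral_nonneg fun p => sq_nonneg _
  set c : ℝ := Real.exp (-v / 2) with hc
  set N : ℝ := (n.factorial : ℝ) with hN
  have hNpos : 0 < N := by rw [hN]; exact_mod_cast n.factorial_pos
  have hcard : (Fintype.card (Equiv.Perm (Fin n)) : ℝ) = N := by
    rw [Fintype.card_perm, Fintype.card_fin]
  have hsec := pc_second (P := P) (fun π => pcW_meas hXm n hg π) c (Real.exp_pos _).le
    (Real.exp_le_one_iff.2 (by linarith))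
  have hc1 : (c : ℂ) = Complex.exp (-(v : ℂ) / 2) := by rw [hc]; push_cast; rfl
  have hc2 : (c : ℂ) ^ 2 = Complex.exp (-((2 * v : ℝ) : ℂ) / 2) := by
    rw [hc1, ← Complex.exp_nat_mul]; congr 1; push_cast; ring
  set A := n * (2 * 4 ^ 2 + 4) * ((Real.sqrt n)⁻¹ * K) ^ 3 with hA
  set B := (n + n) * (2 * 8 ^ 2 + 8) * ((Real.sqrt n)⁻¹ * K) ^ 3 with hB
  have hb : ∑ π : Equiv.Perm (Fin n), ∑ π' : Equiv.Perm (Fin n),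
     (‖(∫ ω, Complex.exp (Complex.I * ((pcW X n g π ω - pcW X n g π' ω : ℝ) : ℂ)) ∂P) - (c : ℂ) ^ 2‖
      + ‖(∫ ω, Complex.exp (Complex.I * (pcW X n g π ω : ℂ)) ∂P) - c‖
      + ‖(∫ ω, Complex.exp (Complex.I * (pcW X n g π' ω : ℂ)) ∂P) - c‖)
      ≤ ∑ π : Equiv.Perm (Fin n), (N * (B + A + A) + ((Real.sqrt n)⁻¹ * K) ^ 2 * (8 * N)) := by
    refine sum_le_sum fun π _ => ?_
    have h1 : ((∑ π' : Equiv.Perm (Fin n),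
      ∑ e, (pcM (Sum.elim (pcA π) (pcA π')) (Sum.elim (pcB π) (pcB π')) e).card : ℕ) : ℝ) ≤ 8 * N := by
      rw [hN]; exact_mod_cast pcM_two hn π
    push_cast at h1
    calc _ ≤ ∑ π' : Equiv.Perm (Fin n), ((B + A + A) + ((Real.sqrt n)⁻¹ * K) ^ 2 *
        ∑ e, ((pcM (Sum.elim (pcA π) (pcA π')) (Sum.elim (pcB π) (pcB π')) e).card : ℝ)) := by
          refine sum_le_sum fun π' _ => ?_
          have t1 := pc_T1 hXm hindep hμ hg hg1 hg2 hK0 hK hn π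
          have t1' := pc_T1 hXm hindep hμ hg hg1 hg2 hK0 hK hn π'
          have t2 := pc_T2 hXm hindep hμ hg hg1 hg2 hK0 hK hn π π'
          rw [← hc1] at t1 t1'
          rw [← hc2] at t2
          linarith
      _ ≤ _ := by
          rw [sum_add_distrib, ← mul_sum, sum_const, card_univ, nsmul_eq_mul, hcard]
          gcongr
  rw [sum_const, card_univ, nsmul_eq_mul, hcard] at hb
  have hphi : ∀ ω, ‖pcPhi X n g ω - (c : ℂ)‖ ^ 2 = (N⁻¹) ^ 2 *
      ‖∑ π : Equiv.Perm (Fin n), (Complex.exp (Complex.I * (pcW X n g π ω : ℂ)) - c)‖ ^ 2 := by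
    intro ω
    have : pcPhi X n g ω - (c : ℂ) = (n.factorial : ℂ)⁻¹ *
      ∑ π : Equiv.Perm (Fin n), (Complex.exp (Complex.I * (pcW X n g π ω : ℂ)) - c) := by
      have hne : (n.factorial : ℂ) ≠ 0 := by exact_mod_cast n.factorial_ne_zero
      rw [sum_sub_distrib, sum_const, card_univ, Fintype.card_perm, Fintype.card_fin, pcPhi,
        nsmul_eq_mul]
      field_simp
    rw [this, norm_mul, mul_pow]
    congr 2
    simp [hN]
  simp_rw [hphi]
  rw [integral_const_mul]
  calc _ ≤ (N⁻¹) ^ 2 * (N * (N * (B + A + A) + ((Real.sqrt n)⁻¹ * K) ^ 2 * (8 * N))) := by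
        gcongr; exact hsec.trans hb
    _ = _ := by rw [hA, hB]; field_simp; ring

lemma pc_bdd_tendsto {Ω E : Type*} [MeasurableSpace Ω] [MeasurableSpace E] {P : Measure Ω}
    [IsProbabilityMeasure P] {μ : Measure E}
    {X : ℕ → Ω → E} (hXm : ∀ i, Measurable (X i)) (hindep : iIndepFun X P)
    (hμ : ∀ i, Measure.map (X i) P = μ) {g : E → E → ℝ} (hg : Measurable (Function.uncurry g))
    (hg1 : ∀ᵐ x ∂μ, ∫ z, g z x ∂μ = 0) (hg2 : ∀ᵐ x ∂μ, ∫ z, g x z ∂μ = 0)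
    {K : ℝ} (hK0 : 0 ≤ K) (hK : ∀ x z, |g x z| ≤ K) :
    Tendsto (fun n => ∫ ω, ‖pcPhi X n g ω
      - (Real.exp (-(∫ p, g p.1 p.2 ^ 2 ∂(μ.prod μ)) / 2) : ℝ)‖ ^ 2 ∂P) atTop (𝓝 0) := by
  have hs : Tendsto (fun n : ℕ => (Real.sqrt n)⁻¹) atTop (𝓝 0) :=
    (Real.tendsto_sqrt_atTop.comp tendsto_natCast_atTop_atTop).inv_tendsto_atTop
  have hlim : Tendsto (fun n : ℕ => 344 * ((Real.sqrt n)⁻¹ * K ^ 3) + 8 * ((Real.sqrt n)⁻¹ * K) ^ 2)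
      atTop (𝓝 0) := by
    have := ((hs.mul_const (K ^ 3)).const_mul 344).add (((hs.mul_const K).pow 2).const_mul 8)
    simpa using this
  refine tendsto_of_tendsto_of_tendsto_of_le_of_le' tendsto_const_nhds hlim
    (Eventually.of_forall fun n => integral_nonneg fun ω => by positivity) ?_
  filter_upwards [eventually_ge_atTop 3] with n hn
  refine (pc_bdd hXm hindep hμ hg hg1 hg2 hK0 hK hn).trans (le_of_eq ?_)
  have hn0 : (0 : ℝ) < n := by exact_mod_cast (by omega : 0 < n)
  have h2 : (n : ℝ) * (Real.sqrt n)⁻¹ ^ 3 = (Real.sqrt n)⁻¹ := by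
    have hp := Real.sqrt_pos.2 hn0
    have := Real.sq_sqrt hn0.le
    field_simp
    linarith
  congr 2
  rw [mul_pow, ← mul_assoc, h2]



lemma pc_memLp {Ω E : Type*} [MeasurableSpace Ω] [MeasurableSpace E] {P : Measure Ω}
    [IsProbabilityMeasure P] {μ : Measure E}
    {X : ℕ → Ω → E} (hXm : ∀ i, Measurable (X i)) (hindep : iIndepFun X P)
    (hμ : ∀ i, Measure.map (X i) P = μ) {h : E → E → ℝ}
    (hL : MemLp (Function.uncurry h) 2 (μ.prod μ)) {a b : ℕ} (hab : a ≠ b) :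
    MemLp (fun ω => h (X a ω) (X b ω)) 2 P := by
  have hm : MeasurePreserving (fun ω => (X a ω, X b ω)) P (μ.prod μ) :=
    ⟨(hXm a).prodMk (hXm b), pc_joint hXm hindep hμ hab⟩
  exact hL.comp_measurePreserving hm

lemma pc_cross {Ω E : Type*} [MeasurableSpace Ω] [MeasurableSpace E] {P : Measure Ω}
    [IsProbabilityMeasure P] {μ : Measure E}
    {X : ℕ → Ω → E} (hXm : ∀ i, Measurable (X i)) (hindep : iIndepFun X P)
    (hμ : ∀ i, Measure.map (X i) P = μ) {h : E → E → ℝ} (hh : Measurable (Function.uncurry h))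
    (hL : MemLp (Function.uncurry h) 2 (μ.prod μ))
    (hg1 : ∀ᵐ x ∂μ, ∫ z, h z x ∂μ = 0) (hg2 : ∀ᵐ x ∂μ, ∫ z, h x z ∂μ = 0)
    {a b a' b' : ℕ} (hab : a ≠ b) (hab' : a' ≠ b') (hne : (a ≠ a' ∧ a ≠ b') ∨ (b ≠ a' ∧ b ≠ b')) :
    ∫ ω, h (X a ω) (X b ω) * h (X a' ω) (X b' ω) ∂P = 0 := by
  have hint : Integrable (fun ω => h (X a ω) (X b ω) * h (X a' ω) (X b' ω)) P :=
    (pc_memLp hXm hindep hμ hL hab).integrable_mul (pc_memLp hXm hindep hμ hL hab')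
  have hintc : Integrable (fun ω => (h (X a ω) (X b ω) : ℂ) * (h (X a' ω) (X b' ω) : ℂ)) P := by
    have := hint.ofReal (𝕜 := ℂ)
    simpa using this
  have hGm : Measurable fun z : ℕ → E => (h (z a') (z b') : ℂ) :=
    Complex.measurable_ofReal.comp (pc_meas2 hh (measurable_pi_apply _) (measurable_pi_apply _))
  have hc : ∫ ω, (h (X a ω) (X b ω) : ℂ) * (h (X a' ω) (X b' ω) : ℂ) ∂P = 0 := by
    rcases hne with ⟨h1, h2⟩ | ⟨h1, h2⟩
    · exact pc_zero hXm hindep hμ hh hg1 hab (G := fun z => (h (z a') (z b') : ℂ)) hGm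
        (fun z x => by simp [Function.update_of_ne h1.symm, Function.update_of_ne h2.symm]) hintc
    · exact pc_zero hXm hindep hμ (v := fun x y => h y x) (hh.comp measurable_swap) hg2 hab.symm
        (G := fun z => (h (z a') (z b') : ℂ)) hGm
        (fun z x => by simp [Function.update_of_ne h1.symm, Function.update_of_ne h2.symm]) hintc
  have : ((∫ ω, h (X a ω) (X b ω) * h (X a' ω) (X b' ω) ∂P : ℝ) : ℂ) = 0 := by
    rw [← integral_complex_ofReal, ← hc]; push_cast; rfl
  exact_mod_cast this

lemma pcW_memLp {Ω E : Type*} [MeasurableSpace Ω] [MeasurableSpace E] {P : Measure Ω}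
    [IsProbabilityMeasure P] {μ : Measure E}
    {X : ℕ → Ω → E} (hXm : ∀ i, Measurable (X i)) (hindep : iIndepFun X P)
    (hμ : ∀ i, Measure.map (X i) P = μ) {h : E → E → ℝ}
    (hL : MemLp (Function.uncurry h) 2 (μ.prod μ)) {n : ℕ} (hn : 3 ≤ n) (π : Equiv.Perm (Fin n)) :
    MemLp (pcW X n h π) 2 P := by
  unfold pcW
  exact memLp_finsetSum _ fun i _ => (pc_memLp hXm hindep hμ hL (pcAB_ne hn π i)).const_mul _

lemma pcW_sq {Ω E : Type*} [MeasurableSpace Ω] [MeasurableSpace E] {P : Measure Ω}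
    [IsProbabilityMeasure P] {μ : Measure E}
    {X : ℕ → Ω → E} (hXm : ∀ i, Measurable (X i)) (hindep : iIndepFun X P)
    (hμ : ∀ i, Measure.map (X i) P = μ) {h : E → E → ℝ} (hh : Measurable (Function.uncurry h))
    (hL : MemLp (Function.uncurry h) 2 (μ.prod μ))
    (hg1 : ∀ᵐ x ∂μ, ∫ z, h z x ∂μ = 0) (hg2 : ∀ᵐ x ∂μ, ∫ z, h x z ∂μ = 0)
    {n : ℕ} (hn : 3 ≤ n) (π : Equiv.Perm (Fin n)) :
    ∫ ω, pcW X n h π ω ^ 2 ∂P = ∫ p, h p.1 p.2 ^ 2 ∂(μ.prod μ) := by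
  have hn0 : (0 : ℝ) < n := by exact_mod_cast (by omega : 0 < n)
  have hint : ∀ i j, Integrable (fun ω => h (X (pcA π i) ω) (X (pcB π i) ω)
      * h (X (pcA π j) ω) (X (pcB π j) ω)) P := fun i j =>
    (pc_memLp hXm hindep hμ hL (pcAB_ne hn π i)).integrable_mul
      (pc_memLp hXm hindep hμ hL (pcAB_ne hn π j))
  have e1 : ∀ ω, pcW X n h π ω ^ 2 = (n : ℝ)⁻¹ * ∑ i, ∑ j, h (X (pcA π i) ω) (X (pcB π i) ω)
      * h (X (pcA π j) ω) (X (pcB π j) ω) := by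
    intro ω
    rw [pcW, ← mul_sum, mul_pow, inv_pow, Real.sq_sqrt hn0.le, sq, sum_mul_sum]
  simp_rw [e1]
  rw [integral_const_mul, integral_finsetSum _ (fun i _ => integrable_finsetSum _ fun j _ => hint i j)]
  have e2 : ∀ i, ∫ ω, ∑ j, h (X (pcA π i) ω) (X (pcB π i) ω)
      * h (X (pcA π j) ω) (X (pcB π j) ω) ∂P = ∫ p, h p.1 p.2 ^ 2 ∂(μ.prod μ) := by
    intro i
    rw [integral_finsetSum _ fun j _ => hint i j, sum_eq_single i]
    · rw [← pc_joint hXm hindep hμ (pcAB_ne hn π i), integral_map]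
      · simp_rw [sq]
      · exact ((hXm _).prodMk (hXm _)).aemeasurable
      · exact ((pc_meas2 hh measurable_fst measurable_snd).pow_const 2).aestronglyMeasurable
    · intro j _ hj
      refine pc_cross hXm hindep hμ hh hL hg1 hg2 (pcAB_ne hn π i) (pcAB_ne hn π j) ?_
      have hM := pcM_one hn π i
      rw [pcM, filter_eq_empty_iff] at hM
      have hM := hM (mem_univ j)
      have hn1 := pcAB_ne hn π i
      have hn2 := pcAB_ne hn π j
      by_contra hcon
      apply hM
      refine ⟨hj, ?_⟩
      grind
    · simp
  rw [sum_congr rfl fun i _ => e2 i]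
  simp [hn0.ne']

lemma pc_jensen {E : Type*} [MeasurableSpace E] {μ : Measure E} [IsProbabilityMeasure μ] {f : E → ℝ}
    (hf : MemLp f 2 μ) : (∫ x, f x ∂μ) ^ 2 ≤ ∫ x, f x ^ 2 ∂μ := by
  have h1 := variance_eq_sub hf
  have h2 := variance_nonneg f μ
  simp only [Pi.pow_apply] at h1
  linarith

lemma pc_bint {E : Type*} [MeasurableSpace E] {μ : Measure E} [IsProbabilityMeasure μ] {f : E → ℝ}
    (hf : Measurable f) {K : ℝ} (hK : ∀ x, |f x| ≤ K) : Integrable f μ :=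
  Integrable.of_bound hf.aestronglyMeasurable K (ae_of_all _ fun x => by simpa using hK x)

lemma pc_bint_le {E : Type*} [MeasurableSpace E] {μ : Measure E} [IsProbabilityMeasure μ] {f : E → ℝ}
    {K : ℝ} (hK : ∀ x, |f x| ≤ K) : |∫ x, f x ∂μ| ≤ K := by
  have := norm_integral_le_of_norm_le_const (μ := μ) (f := f) (C := K)
    (ae_of_all _ fun x => by simpa using hK x)
  simpa using this

/-- marginal means are controlled by the truncation error -/
lemma pc_marg {E : Type*} [MeasurableSpace E] {μ : Measure E} [IsProbabilityMeasure μ]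
    {h k : E → E → ℝ} (hk : Measurable (Function.uncurry k)) {K : ℝ} (hK : ∀ x y, |k x y| ≤ K)
    (hL : MemLp (Function.uncurry h) 2 (μ.prod μ)) (h2 : ∀ᵐ x ∂μ, ∫ z, h x z ∂μ = 0) :
    ∫ x, (∫ z, k x z ∂μ) ^ 2 ∂μ ≤ ∫ p, (h p.1 p.2 - k p.1 p.2) ^ 2 ∂(μ.prod μ) := by
  have hkL : MemLp (Function.uncurry k) 2 (μ.prod μ) :=
    MemLp.of_bound hk.aestronglyMeasurable K (ae_of_all _ fun p => hK p.1 p.2)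
  have hd := hL.sub hkL
  have hdi : Integrable (fun p : E × E => (h p.1 p.2 - k p.1 p.2) ^ 2) (μ.prod μ) := hd.integrable_sq
  have hBm : Measurable fun x => ∫ z, k x z ∂μ :=
    (StronglyMeasurable.integral_prod_right (f := k) hk.stronglyMeasurable).measurable
  have hB : ∀ x, |∫ z, k x z ∂μ| ≤ K := fun x => pc_bint_le (hK x)
  rw [integral_prod _ hdi]
  refine integral_mono_ae ?_ hdi.integral_prod_left ?_
  · exact pc_bint (K := K ^ 2) (hBm.pow_const 2) fun x => by
      rw [abs_pow]; exact pow_le_pow_left₀ (abs_nonneg _) (hB x) 2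
  · filter_upwards [h2, hdi.prod_right_ae, (hL.integrable one_le_two).prod_right_ae,
      hd.aestronglyMeasurable.prodMk_left] with x hx hxi hxh hxm
    have hki : Integrable (fun z => k x z) μ := pc_bint (hk.comp measurable_prodMk_left) (hK x)
    have e : ∫ z, k x z ∂μ = - ∫ z, (h x z - k x z) ∂μ := by
      rw [integral_sub (f := fun z => h x z) hxh hki]
      rw [hx]; ring
    rw [e, neg_sq]
    exact pc_jensen ((memLp_two_iff_integrable_sq hxm).2 hxi)

lemma pc_approx {E : Type*} [MeasurableSpace E] {μ : Measure E} [IsProbabilityMeasure μ]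
    {h : E → E → ℝ} (hh : Measurable (Function.uncurry h))
    (hL : MemLp (Function.uncurry h) 2 (μ.prod μ))
    (hg1 : ∀ᵐ x ∂μ, ∫ z, h z x ∂μ = 0) (hg2 : ∀ᵐ x ∂μ, ∫ z, h x z ∂μ = 0)
    {ε : ℝ} (hε : 0 < ε) :
    ∃ (g : E → E → ℝ) (K : ℝ), Measurable (Function.uncurry g) ∧ 0 ≤ K ∧ (∀ x y, |g x y| ≤ K) ∧
      (∀ x, ∫ z, g z x ∂μ = 0) ∧ (∀ x, ∫ z, g x z ∂μ = 0) ∧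
      ∫ p, (h p.1 p.2 - g p.1 p.2) ^ 2 ∂(μ.prod μ) ≤ ε := by
  set k : ℕ → E → E → ℝ := fun K x y => max (-(K : ℝ)) (min (h x y) K) with hk
  have hkm : ∀ K, Measurable (Function.uncurry (k K)) := fun K =>
    measurable_const.max (hh.min measurable_const)
  have hkb : ∀ K x y, |k K x y| ≤ K := by
    intro K x y
    have : (0 : ℝ) ≤ K := Nat.cast_nonneg K
    rw [abs_le]
    exact ⟨le_max_left _ _, max_le (by linarith) (min_le_right _ _)⟩
  have hlim : Tendsto (fun K => ∫ p, (h p.1 p.2 - k K p.1 p.2) ^ 2 ∂(μ.prod μ)) atTop (𝓝 0) := by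
    have : (0 : ℝ) = ∫ p : E × E, (0 : ℝ) ∂(μ.prod μ) := by simp
    rw [this]
    refine tendsto_integral_of_dominated_convergence (fun p => h p.1 p.2 ^ 2) ?_ hL.integrable_sq ?_ ?_
    · intro K
      exact ((hh.sub (hkm K)).pow_const 2).aestronglyMeasurable
    · intro K
      refine ae_of_all _ fun p => ?_
      have : (0 : ℝ) ≤ K := Nat.cast_nonneg K
      rw [Real.norm_of_nonneg (sq_nonneg _)]
      apply sq_le_sq.2
      simp only [hk]
      rcases max_cases (-(K : ℝ)) (min (h p.1 p.2) K) with h1 | h1 <;>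
      rcases min_cases (h p.1 p.2) (K : ℝ) with h2 | h2 <;>
      rw [abs_le] <;> constructor <;> cases abs_cases (h p.1 p.2) <;> linarith
    · refine ae_of_all _ fun p => ?_
      obtain ⟨K0, hK0⟩ := exists_nat_ge |h p.1 p.2|
      refine tendsto_const_nhds.congr' ?_
      filter_upwards [eventually_ge_atTop K0] with K hK
      have h1 : |h p.1 p.2| ≤ K := hK0.trans (by exact_mod_cast hK)
      rw [abs_le] at h1
      simp only [hk]
      rw [min_eq_left h1.2, max_eq_right h1.1]; simp
  obtain ⟨K, hK⟩ := (hlim.eventually (gt_mem_nhds (by positivity : 0 < ε / 16))).exists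
  have hK0 : (0 : ℝ) ≤ K := Nat.cast_nonneg K
  set m := k K with hm
  have hmm : Measurable (Function.uncurry m) := hkm K
  have hmb := hkb K
  have hms : Measurable (Function.uncurry fun x y => m y x) := hmm.comp measurable_swap
  set A : E → ℝ := fun y => ∫ x, m x y ∂μ with hA
  set B : E → ℝ := fun x => ∫ y, m x y ∂μ with hB
  set C : ℝ := ∫ x, B x ∂μ with hC
  have hAm : Measurable A :=
    (StronglyMeasurable.integral_prod_right (f := fun x y => m y x) hms.stronglyMeasurable).measurable
  have hBm : Measurable B :=
    (StronglyMeasurable.integral_prod_right (f := m) hmm.stronglyMeasurable).measurable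
  have hAb : ∀ y, |A y| ≤ K := fun y => pc_bint_le fun x => hmb x y
  have hBb : ∀ y, |B y| ≤ K := fun y => pc_bint_le fun x => hmb y x
  have hCb : |C| ≤ K := pc_bint_le hBb
  have hmi : Integrable (Function.uncurry m) (μ.prod μ) := pc_bint hmm fun p => hmb p.1 p.2
  have hAC : ∫ y, A y ∂μ = C := (integral_integral_swap hmi).symm
  have hAi : Integrable A μ := pc_bint hAm hAb
  have hBi : Integrable B μ := pc_bint hBm hBb
  have hm1 : ∀ y, Integrable (fun x => m x y) μ := fun y =>
    pc_bint (hmm.comp measurable_prodMk_right) fun x => hmb x y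
  have hm2 : ∀ x, Integrable (fun y => m x y) μ := fun y =>
    pc_bint (hmm.comp measurable_prodMk_left) fun x => hmb y x
  refine ⟨fun x y => m x y - A y - B x + C, 4 * K, ?_, by positivity, ?_, ?_, ?_, ?_⟩
  · exact ((hmm.sub (hAm.comp measurable_snd)).sub (hBm.comp measurable_fst)).add measurable_const
  · intro x y
    have h1 := abs_le.1 (hmb x y); have h2 := abs_le.1 (hAb y)
    have h3 := abs_le.1 (hBb x); have h4 := abs_le.1 hCb
    rw [abs_le]; constructor <;> linarith
  · intro y
    rw [integral_add, integral_sub, integral_sub (hm1 y) (integrable_const _)]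
    · simp only [integral_const, probReal_univ, one_smul]
      rw [← hC]; change A y - A y - C + C = 0; ring
    · exact (hm1 y).sub (integrable_const _)
    · exact hBi
    · exact ((hm1 y).sub (integrable_const _)).sub hBi
    · exact integrable_const _
  · intro x
    rw [integral_add, integral_sub, integral_sub (hm2 x) hAi]
    · simp only [integral_const, probReal_univ, one_smul]
      rw [hAC]; change B x - C - B x + C = 0; ring
    · exact (hm2 x).sub hAi
    · exact integrable_const _
    · exact ((hm2 x).sub hAi).sub (integrable_const _)
    · exact integrable_const _
  · set δ := ∫ p, (h p.1 p.2 - m p.1 p.2) ^ 2 ∂(μ.prod μ) with hδ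
    have hB2 : ∫ x, B x ^ 2 ∂μ ≤ δ := pc_marg hmm hmb hL hg2
    have hLs : MemLp (Function.uncurry fun x y => h y x) 2 (μ.prod μ) :=
      hL.comp_measurePreserving (Measure.measurePreserving_swap)
    have hA2 : ∫ x, A x ^ 2 ∂μ ≤ δ := by
      have := pc_marg hms (fun x y => hmb y x) hLs hg1
      refine this.trans (le_of_eq ?_)
      rw [hδ, ← integral_prod_swap]; rfl
    have hC2 : C ^ 2 ≤ δ := (pc_jensen (MemLp.of_bound hBm.aestronglyMeasurable K
      (ae_of_all _ fun p => by simpa using hBb p))).trans hB2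
    have hmL : MemLp (Function.uncurry m) 2 (μ.prod μ) :=
      MemLp.of_bound hmm.aestronglyMeasurable K (ae_of_all _ fun p => hmb p.1 p.2)
    have i1 : Integrable (fun p : E × E => (h p.1 p.2 - m p.1 p.2) ^ 2) (μ.prod μ) :=
      (hL.sub hmL).integrable_sq
    have i2 : Integrable (fun p : E × E => A p.2 ^ 2) (μ.prod μ) :=
      pc_bint (K := K ^ 2) ((hAm.comp measurable_snd).pow_const 2) fun p => by
        rw [abs_pow]; exact pow_le_pow_left₀ (abs_nonneg _) (hAb _) 2
    have i3 : Integrable (fun p : E × E => B p.1 ^ 2) (μ.prod μ) :=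
      pc_bint (K := K ^ 2) ((hBm.comp measurable_fst).pow_const 2) fun p => by
        rw [abs_pow]; exact pow_le_pow_left₀ (abs_nonneg _) (hBb _) 2
    have e2 : ∫ p : E × E, A p.2 ^ 2 ∂(μ.prod μ) = ∫ x, A x ^ 2 ∂μ := by
      rw [integral_prod _ i2]; simp
    have e3 : ∫ p : E × E, B p.1 ^ 2 ∂(μ.prod μ) = ∫ x, B x ^ 2 ∂μ := by
      rw [integral_prod _ i3]; simp
    calc _ ≤ ∫ p : E × E, (4 * ((h p.1 p.2 - m p.1 p.2) ^ 2 + A p.2 ^ 2 + B p.1 ^ 2 + C ^ 2)) ∂(μ.prod μ) := by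
          refine integral_mono_of_nonneg (ae_of_all _ fun p => sq_nonneg _)
            ((((i1.add i2).add i3).add (integrable_const _)).const_mul 4) (ae_of_all _ fun p => ?_)
          set d := h p.1 p.2 - m p.1 p.2 with hd
          have : h p.1 p.2 - (m p.1 p.2 - A p.2 - B p.1 + C) = d + A p.2 + B p.1 - C := by
            rw [hd]; ring
          simp only [this]
          nlinarith [sq_nonneg (d - A p.2), sq_nonneg (d - B p.1), sq_nonneg (d + C),
            sq_nonneg (A p.2 - B p.1), sq_nonneg (A p.2 + C), sq_nonneg (B p.1 + C)]
      _ = 4 * (δ + (∫ x, A x ^ 2 ∂μ) + (∫ x, B x ^ 2 ∂μ) + C ^ 2) := by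
          have i12 : Integrable (fun p : E × E => (h p.1 p.2 - m p.1 p.2) ^ 2 + A p.2 ^ 2) (μ.prod μ) :=
            i1.add i2
          have i123 : Integrable (fun p : E × E => (h p.1 p.2 - m p.1 p.2) ^ 2 + A p.2 ^ 2
            + B p.1 ^ 2) (μ.prod μ) := i12.add i3
          rw [integral_const_mul, integral_add i123 (integrable_const _),
            integral_add i12 i3, integral_add i1 i2, e2, e3]
          simp [hδ]
      _ ≤ ε := by linarith



lemma pc_exp_lip (x y : ℝ) :
    ‖Complex.exp (Complex.I * (x : ℂ)) - Complex.exp (Complex.I * (y : ℂ))‖ ≤ |x - y| := by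
  have h := Real.norm_exp_I_mul_ofReal_sub_one_le (x := x - y)
  have e : Complex.exp (Complex.I * (x : ℂ)) - Complex.exp (Complex.I * (y : ℂ))
      = Complex.exp (Complex.I * (y : ℂ)) * (Complex.exp (Complex.I * ((x - y : ℝ) : ℂ)) - 1) := by
    rw [mul_sub, ← Complex.exp_add, mul_one]
    congr 2; push_cast; ring
  rw [e, norm_mul, mul_comm Complex.I (y : ℂ), Complex.norm_exp_ofReal_mul_I, one_mul]
  simpa using h

lemma pc_rexp_lip {a b : ℝ} (ha : 0 ≤ a) (hb : 0 ≤ b) :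
    |Real.exp (-a / 2) - Real.exp (-b / 2)| ≤ |a - b| / 2 := by
  have key : ∀ a b : ℝ, 0 ≤ a → a ≤ b → |Real.exp (-a / 2) - Real.exp (-b / 2)| ≤ |a - b| / 2 := by
    intro a b ha hab
    have h1 : Real.exp (-b / 2) ≤ Real.exp (-a / 2) := Real.exp_le_exp.2 (by linarith)
    rw [abs_of_nonneg (by linarith), abs_of_nonpos (by linarith)]
    have h2 : Real.exp (-b / 2) = Real.exp (-a / 2) * Real.exp (-(b - a) / 2) := by
      rw [← Real.exp_add]; congr 1; ring
    have h3 := Real.add_one_le_exp (-(b - a) / 2)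
    have h4 : Real.exp (-a / 2) ≤ 1 := Real.exp_le_one_iff.2 (by linarith)
    have h5 := Real.exp_pos (-a / 2)
    rw [h2]
    nlinarith
  rcases le_total a b with h | h
  · exact key a b ha h
  · rw [abs_sub_comm, abs_sub_comm a b]; exact key b a hb h

lemma pcPhi_meas {Ω E : Type*} [MeasurableSpace Ω] [MeasurableSpace E]
    {X : ℕ → Ω → E} (hXm : ∀ i, Measurable (X i)) (n : ℕ) {g : E → E → ℝ}
    (hg : Measurable (Function.uncurry g)) : Measurable (pcPhi X n g) := by
  unfold pcPhi
  have := pcW_meas hXm n hg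
  fun_prop

lemma pcPhi_norm {Ω E : Type*} (X : ℕ → Ω → E) (n : ℕ) (g : E → E → ℝ) (ω : Ω) :
    ‖pcPhi X n g ω‖ ≤ 1 := by
  have hN : (0 : ℝ) < n.factorial := by exact_mod_cast n.factorial_pos
  rw [pcPhi, norm_mul]
  calc _ ≤ ‖(n.factorial : ℂ)⁻¹‖ * ∑ π : Equiv.Perm (Fin n), (1 : ℝ) := by
        gcongr
        refine (norm_sum_le _ _).trans (sum_le_sum fun π _ => ?_)
        rw [mul_comm, Complex.norm_exp_ofReal_mul_I]
    _ = 1 := by simp [Fintype.card_perm, hN.ne']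

lemma pcPhi_sub {Ω E : Type*} (X : ℕ → Ω → E) (n : ℕ) (g h : E → E → ℝ) (ω : Ω) :
    ‖pcPhi X n h ω - pcPhi X n g ω‖ ^ 2 ≤ (n.factorial : ℝ)⁻¹ *
      ∑ π : Equiv.Perm (Fin n), pcW X n (fun x y => h x y - g x y) π ω ^ 2 := by
  have hN : (0 : ℝ) < n.factorial := by exact_mod_cast n.factorial_pos
  have h1 : ‖pcPhi X n h ω - pcPhi X n g ω‖ ≤ (n.factorial : ℝ)⁻¹ *
      ∑ π : Equiv.Perm (Fin n), |pcW X n (fun x y => h x y - g x y) π ω| := by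
    rw [pcPhi, pcPhi, ← mul_sub, norm_mul, ← sum_sub_distrib]
    have : ‖(n.factorial : ℂ)⁻¹‖ = (n.factorial : ℝ)⁻¹ := by simp
    rw [this]
    gcongr
    refine (norm_sum_le _ _).trans (sum_le_sum fun π _ => (pc_exp_lip _ _).trans (le_of_eq ?_))
    congr 1
    simp only [pcW, mul_sub, sum_sub_distrib]
  have h2 := sq_sum_le_card_mul_sum_sq (s := (univ : Finset (Equiv.Perm (Fin n))))
    (f := fun π => |pcW X n (fun x y => h x y - g x y) π ω|)
  rw [card_univ, Fintype.card_perm, Fintype.card_fin] at h2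
  simp only [sq_abs] at h2
  calc _ ≤ ((n.factorial : ℝ)⁻¹ *
      ∑ π : Equiv.Perm (Fin n), |pcW X n (fun x y => h x y - g x y) π ω|) ^ 2 :=
        pow_le_pow_left₀ (norm_nonneg _) h1 2
    _ ≤ (n.factorial : ℝ)⁻¹ ^ 2 * (n.factorial * ∑ π : Equiv.Perm (Fin n),
        pcW X n (fun x y => h x y - g x y) π ω ^ 2) := by
        rw [mul_pow]; gcongr
    _ = _ := by field_simp

lemma pc_L2 {Ω E : Type*} [MeasurableSpace Ω] [MeasurableSpace E] {P : Measure Ω}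
    [IsProbabilityMeasure P] {μ : Measure E}
    {X : ℕ → Ω → E} (hXm : ∀ i, Measurable (X i)) (hindep : iIndepFun X P)
    (hμ : ∀ i, Measure.map (X i) P = μ) {h : E → E → ℝ} (hh : Measurable (Function.uncurry h))
    (hL : MemLp (Function.uncurry h) 2 (μ.prod μ))
    (hg1 : ∀ᵐ x ∂μ, ∫ z, h z x ∂μ = 0) (hg2 : ∀ᵐ x ∂μ, ∫ z, h x z ∂μ = 0) :
    Tendsto (fun n => ∫ ω, ‖pcPhi X n h ω
      - (Real.exp (-(∫ p, h p.1 p.2 ^ 2 ∂(μ.prod μ)) / 2) : ℝ)‖ ^ 2 ∂P) atTop (𝓝 0) := by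
  have hprob : IsProbabilityMeasure μ := by
    rw [← hμ 0]; exact Measure.isProbabilityMeasure_map (hXm 0).aemeasurable
  set v := ∫ p, h p.1 p.2 ^ 2 ∂(μ.prod μ) with hv
  have hv0 : 0 ≤ v := integral_nonneg fun p => sq_nonneg _
  rw [Metric.tendsto_nhds]
  intro ε hε
  set C : ℝ := 3 * (2 + ((v + 2) / 2) ^ 2) with hC
  have hCpos : 0 < C := by positivity
  set δ : ℝ := min 1 (ε / (2 * C)) with hδ
  have hδ0 : 0 < δ := lt_min one_pos (by positivity)
  have hδ1 : δ ≤ 1 := min_le_left _ _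
  have hδ2 : δ ^ 2 * C < ε := by
    have : δ ≤ ε / (2 * C) := min_le_right _ _
    rw [le_div_iff₀ (by positivity)] at this
    have h3 : δ ^ 2 * C ≤ δ * C := by
      have : δ ^ 2 ≤ δ := by nlinarith
      gcongr
    linarith
  obtain ⟨g, K, hgm, hK0, hK, hga, hgb, hgd⟩ := pc_approx hh hL hg1 hg2 (by positivity : 0 < δ ^ 2)
  have hgL : MemLp (Function.uncurry g) 2 (μ.prod μ) :=
    MemLp.of_bound hgm.aestronglyMeasurable K (ae_of_all _ fun p => hK p.1 p.2)
  set d : E → E → ℝ := fun x y => h x y - g x y with hd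
  have hdm : Measurable (Function.uncurry d) := hh.sub hgm
  have hdL : MemLp (Function.uncurry d) 2 (μ.prod μ) := hL.sub hgL
  have hki1 : ∀ y, Integrable (fun x => g x y) μ := fun y =>
    pc_bint (hgm.comp measurable_prodMk_right) fun x => hK x y
  have hki2 : ∀ x, Integrable (fun y => g x y) μ := fun y =>
    pc_bint (hgm.comp measurable_prodMk_left) fun x => hK y x
  have hd1 : ∀ᵐ x ∂μ, ∫ z, d z x ∂μ = 0 := by
    filter_upwards [hg1, (hL.integrable one_le_two).prod_left_ae] with x hx hi
    rw [integral_sub (f := fun z => h z x) hi (hki1 x), hx, hga x, sub_zero]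
  have hd2 : ∀ᵐ x ∂μ, ∫ z, d x z ∂μ = 0 := by
    filter_upwards [hg2, (hL.integrable one_le_two).prod_right_ae] with x hx hi
    rw [integral_sub (f := fun z => h x z) hi (hki2 x), hx, hgb x, sub_zero]
  set w := ∫ p, g p.1 p.2 ^ 2 ∂(μ.prod μ) with hw
  have hw0 : 0 ≤ w := integral_nonneg fun p => sq_nonneg _
  have ih2 : Integrable (fun p : E × E => h p.1 p.2 ^ 2) (μ.prod μ) := hL.integrable_sq
  have ig2 : Integrable (fun p : E × E => g p.1 p.2 ^ 2) (μ.prod μ) := hgL.integrable_sq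
  have id2 : Integrable (fun p : E × E => d p.1 p.2 ^ 2) (μ.prod μ) := hdL.integrable_sq
  have hvw : |v - w| ≤ δ * (v + 2) := by
    rw [hv, hw, ← integral_sub ih2 ig2]
    calc |∫ p : E × E, (h p.1 p.2 ^ 2 - g p.1 p.2 ^ 2) ∂(μ.prod μ)|
        ≤ ∫ p : E × E, |h p.1 p.2 ^ 2 - g p.1 p.2 ^ 2| ∂(μ.prod μ) := abs_integral_le_integral_abs
      _ ≤ ∫ p : E × E, (δ * h p.1 p.2 ^ 2 + (2 * δ⁻¹) * d p.1 p.2 ^ 2) ∂(μ.prod μ) := by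
          refine integral_mono (ih2.sub ig2).abs ((ih2.const_mul _).add (id2.const_mul _)) fun p => ?_
          have e : g p.1 p.2 = h p.1 p.2 - d p.1 p.2 := by simp [hd]
          simp only [e]
          generalize h p.1 p.2 = a
          generalize d p.1 p.2 = b
          have h1 : 1 ≤ δ⁻¹ := (one_le_inv₀ hδ0).2 hδ1
          have h2 : δ * δ⁻¹ = 1 := mul_inv_cancel₀ hδ0.ne'
          have h3 : 0 < δ⁻¹ := by positivity
          have h4 : δ * (a - δ⁻¹ * b) ^ 2 = δ * a ^ 2 - 2 * a * b + δ⁻¹ * b ^ 2 := by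
            field_simp; ring
          have h5 : δ * (a + δ⁻¹ * b) ^ 2 = δ * a ^ 2 + 2 * a * b + δ⁻¹ * b ^ 2 := by
            field_simp; ring
          have h6 : 0 ≤ δ * (a - δ⁻¹ * b) ^ 2 := by positivity
          have h7 : 0 ≤ δ * (a + δ⁻¹ * b) ^ 2 := by positivity
          have h8 : b ^ 2 ≤ δ⁻¹ * b ^ 2 := le_mul_of_one_le_left (sq_nonneg _) h1
          rw [abs_le]; constructor <;> nlinarith [sq_nonneg b]
      _ = δ * v + (2 * δ⁻¹) * ∫ p, d p.1 p.2 ^ 2 ∂(μ.prod μ) := by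
          rw [integral_add (ih2.const_mul _) (id2.const_mul _), integral_const_mul, integral_const_mul]
      _ ≤ δ * v + (2 * δ⁻¹) * δ ^ 2 := by gcongr
      _ = _ := by field_simp; try ring
  have hcc : |Real.exp (-v / 2) - Real.exp (-w / 2)| ≤ δ * ((v + 2) / 2) :=
    (pc_rexp_lip hv0 hw0).trans (by linarith)
  have hT := pc_bdd_tendsto hXm hindep hμ hgm (ae_of_all _ hga) (ae_of_all _ hgb) hK0 hK
  filter_upwards [hT.eventually (gt_mem_nhds (by positivity : 0 < δ ^ 2)), eventually_ge_atTop 3]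
    with n hn1 hn
  rw [Real.dist_0_eq_abs, abs_of_nonneg (integral_nonneg fun ω => by positivity)]
  have hN : (0 : ℝ) < n.factorial := by exact_mod_cast n.factorial_pos
  have iW : ∀ π, Integrable (fun ω => pcW X n d π ω ^ 2) P := fun π =>
    (pcW_memLp hXm hindep hμ hdL hn π).integrable_sq
  have iWs : Integrable (fun ω => (n.factorial : ℝ)⁻¹ * ∑ π : Equiv.Perm (Fin n), pcW X n d π ω ^ 2) P :=
    (integrable_finsetSum _ fun π _ => iW π).const_mul _
  have iG : Integrable (fun ω => ‖pcPhi X n g ω - (Real.exp (-w / 2) : ℝ)‖ ^ 2) P := by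
    have hm := pcPhi_meas hXm n hgm
    refine pc_bint (K := 4) (by fun_prop) fun ω => ?_
    rw [abs_pow, abs_norm]
    have : ‖pcPhi X n g ω - (Real.exp (-w / 2) : ℝ)‖ ≤ 2 := by
      refine (norm_sub_le _ _).trans ?_
      have h1 := pcPhi_norm X n g ω
      have h2 : ‖((Real.exp (-w / 2) : ℝ) : ℂ)‖ ≤ 1 := by
        rw [Complex.norm_real, Real.norm_of_nonneg (Real.exp_pos _).le]
        exact Real.exp_le_one_iff.2 (by linarith)
      linarith
    nlinarith [norm_nonneg (pcPhi X n g ω - (Real.exp (-w / 2) : ℝ))]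
  have hE : ∫ ω, (n.factorial : ℝ)⁻¹ * ∑ π : Equiv.Perm (Fin n), pcW X n d π ω ^ 2 ∂P ≤ δ ^ 2 := by
    rw [integral_const_mul, integral_finsetSum _ fun π _ => iW π]
    rw [sum_congr rfl fun π _ => pcW_sq hXm hindep hμ hdm hdL hd1 hd2 hn π]
    rw [sum_const, card_univ, Fintype.card_perm, Fintype.card_fin, nsmul_eq_mul, ← mul_assoc,
      inv_mul_cancel₀ hN.ne', one_mul]
    exact hgd
  calc _ ≤ ∫ ω, (3 * ((n.factorial : ℝ)⁻¹ * ∑ π : Equiv.Perm (Fin n), pcW X n d π ω ^ 2)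
        + 3 * ‖pcPhi X n g ω - (Real.exp (-w / 2) : ℝ)‖ ^ 2 + 3 * (δ * ((v + 2) / 2)) ^ 2) ∂P := by
        refine integral_mono_of_nonneg (ae_of_all _ fun p => by positivity)
          (((iWs.const_mul 3).add (iG.const_mul 3)).add (integrable_const _)) (ae_of_all _ fun ω => ?_)
        simp only
        have h1 := pcPhi_sub X n g h ω
        have h2 : ‖pcPhi X n h ω - (Real.exp (-v / 2) : ℝ)‖ ≤ ‖pcPhi X n h ω - pcPhi X n g ω‖ +
          ‖pcPhi X n g ω - (Real.exp (-w / 2) : ℝ)‖ + |Real.exp (-v / 2) - Real.exp (-w / 2)| := by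
          have h3 : |Real.exp (-v / 2) - Real.exp (-w / 2)|
            = ‖((Real.exp (-w / 2) : ℝ) : ℂ) - (Real.exp (-v / 2) : ℝ)‖ := by
            rw [← Complex.ofReal_sub, Complex.norm_real, Real.norm_eq_abs, abs_sub_comm]
          rw [h3]
          refine le_trans (le_of_eq ?_) (norm_add₃_le)
          congr 1; ring
        have h4 := h2.trans (add_le_add le_rfl hcc)
        have h5 := pow_le_pow_left₀ (norm_nonneg _) h4 2
        generalize ‖pcPhi X n h ω - pcPhi X n g ω‖ = a at *
        generalize ‖pcPhi X n g ω - (Real.exp (-w / 2) : ℝ)‖ = b at *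
        generalize δ * ((v + 2) / 2) = c at *
        nlinarith [sq_nonneg (a - b), sq_nonneg (a - c), sq_nonneg (b - c)]
    _ = 3 * (∫ ω, (n.factorial : ℝ)⁻¹ * ∑ π : Equiv.Perm (Fin n), pcW X n d π ω ^ 2 ∂P)
        + 3 * (∫ ω, ‖pcPhi X n g ω - (Real.exp (-w / 2) : ℝ)‖ ^ 2 ∂P) + 3 * (δ * ((v + 2) / 2)) ^ 2 := by
        have i12 : Integrable (fun ω => 3 * ((n.factorial : ℝ)⁻¹ *
          ∑ π : Equiv.Perm (Fin n), pcW X n d π ω ^ 2)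
          + 3 * ‖pcPhi X n g ω - (Real.exp (-w / 2) : ℝ)‖ ^ 2) P := (iWs.const_mul 3).add (iG.const_mul 3)
        rw [integral_add i12 (integrable_const _), integral_add (iWs.const_mul 3) (iG.const_mul 3),
          integral_const_mul (3 : ℝ), integral_const_mul (3 : ℝ)]
        simp
    _ ≤ δ ^ 2 * C := by rw [hC]; nlinarith
    _ < ε := hδ2



lemma pc_det {F : Type*} [NormedAddCommGroup F] [InnerProductSpace ℝ F] [FiniteDimensional ℝ F]
    [MeasurableSpace F] [BorelSpace F] (γ : ProbabilityMeasure F) {ε : ℝ} (hε : 0 < ε)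
    {M : ℝ} (hM : 0 < M) :
    ∃ (T : Finset F) (δ : ℝ), 0 < δ ∧ ∀ ν : ProbabilityMeasure F,
      (∀ s t, ‖charFun (ν : Measure F) s - charFun (ν : Measure F) t‖ ≤ M * ‖s - t‖) →
      (∀ t ∈ T, ‖charFun (ν : Measure F) t - charFun (γ : Measure F) t‖ < δ) →
      levyProkhorovDist (ν : Measure F) γ < ε := by
  classical
  by_contra! hcon
  have hc := fun m : ℕ => hcon ((Finset.range m).image (TopologicalSpace.denseSeq F))
    (1 / ((m : ℝ) + 1)) (by positivity)
  choose ν hlip hT hge using hc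
  have hconv : ∀ t : F, Tendsto (fun m => charFun (ν m : Measure F) t) atTop
      (𝓝 (charFun (γ : Measure F) t)) := by
    intro t
    rw [Metric.tendsto_nhds]
    intro η hη
    have hcont : Continuous (charFun (γ : Measure F)) := by fun_prop
    have h1 : ∀ᶠ s in 𝓝 t, dist (charFun (γ : Measure F) s) (charFun (γ : Measure F) t) < η / 3 :=
      Metric.tendsto_nhds.1 hcont.continuousAt _ (by positivity)
    have h2 : ∀ᶠ s in 𝓝 t, dist s t < η / (3 * M) := Metric.ball_mem_nhds _ (by positivity)
    obtain ⟨k, hk⟩ := (TopologicalSpace.denseRange_denseSeq F).exists_mem_open isOpen_interior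
      ⟨t, mem_interior_iff_mem_nhds.2 (h1.and h2)⟩
    obtain ⟨hk1, hk2⟩ := interior_subset hk
    have h3 : ∀ᶠ m : ℕ in atTop, 1 / ((m : ℝ) + 1) < η / 3 :=
      tendsto_one_div_add_atTop_nhds_zero_nat.eventually (gt_mem_nhds (by positivity))
    filter_upwards [h3, eventually_gt_atTop k] with m hm hmk
    set s := TopologicalSpace.denseSeq F k with hs
    have a1 := hT m s (Finset.mem_image_of_mem _ (Finset.mem_range.2 hmk))
    have a2 := hlip m t s
    rw [dist_eq_norm] at hk1 hk2 ⊢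
    rw [lt_div_iff₀ (by positivity)] at hk2
    rw [norm_sub_rev t s] at a2
    have e : charFun (ν m : Measure F) t - charFun (γ : Measure F) t =
      (charFun (ν m : Measure F) t - charFun (ν m : Measure F) s) +
      (charFun (ν m : Measure F) s - charFun (γ : Measure F) s) +
      (charFun (γ : Measure F) s - charFun (γ : Measure F) t) := by ring
    rw [e]
    have := norm_add₃_le (a := charFun (ν m : Measure F) t - charFun (ν m : Measure F) s)
      (b := charFun (ν m : Measure F) s - charFun (γ : Measure F) s)
      (c := charFun (γ : Measure F) s - charFun (γ : Measure F) t)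
    linarith
  have hw := ProbabilityMeasure.tendsto_of_tendsto_charFun hconv
  have hw2 := (LevyProkhorov.continuous_ofMeasure_probabilityMeasure (Ω := F)).tendsto γ |>.comp hw
  have hw3 := (Metric.tendsto_nhds.1 hw2) ε hε
  obtain ⟨m, hm⟩ := hw3.exists
  rw [LevyProkhorov.dist_probabilityMeasure_def] at hm
  exact absurd hm (not_lt.2 (hge m))

lemma pc_markov {Ω : Type*} [MeasurableSpace Ω] {P : Measure Ω} [IsProbabilityMeasure P]
    {f : Ω → ℝ} (hf0 : ∀ ω, 0 ≤ f ω) (hf : Integrable f P) {a : ℝ} (ha : 0 < a) :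
    P {ω | a ≤ f ω} ≤ ENNReal.ofReal ((∫ ω, f ω ∂P) / a) := by
  have h := mul_meas_ge_le_integral_of_nonneg (ae_of_all _ hf0) hf a
  rw [← ofReal_measureReal]
  apply ENNReal.ofReal_le_ofReal
  rw [le_div_iff₀ ha]; linarith

lemma pc_prob {Ω F : Type*} [MeasurableSpace Ω] {P : Measure Ω} [IsProbabilityMeasure P]
    [NormedAddCommGroup F] [InnerProductSpace ℝ F] [FiniteDimensional ℝ F]
    [MeasurableSpace F] [BorelSpace F] (γ : Measure F) [hγ : IsProbabilityMeasure γ]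
    (ν : ℕ → Ω → Measure F) (hν : ∀ n ω, IsProbabilityMeasure (ν n ω))
    (Q : ℕ → Ω → ℝ) (hQ0 : ∀ n ω, 0 ≤ Q n ω) (V : ℝ)
    (hQ : ∀ᶠ n in atTop, Integrable (Q n) P ∧ ∫ ω, Q n ω ∂P ≤ V)
    (hlip : ∀ n ω s t, ‖charFun (ν n ω) s - charFun (ν n ω) t‖ ≤ (1 + Q n ω) * ‖s - t‖)
    (hint : ∀ n t, Integrable (fun ω => ‖charFun (ν n ω) t - charFun γ t‖ ^ 2) P)
    (hconv : ∀ t, Tendsto (fun n => ∫ ω, ‖charFun (ν n ω) t - charFun γ t‖ ^ 2 ∂P) atTop (𝓝 0))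
    {ε : ℝ} (hε : 0 < ε) :
    Tendsto (fun n => P {ω | ε ≤ levyProkhorovDist (ν n ω) γ}) atTop (𝓝 0) := by
  have hV : 0 ≤ V := by
    obtain ⟨n, hn⟩ := hQ.exists
    exact (integral_nonneg (hQ0 n)).trans hn.2
  rw [ENNReal.tendsto_nhds_zero]
  intro η hη
  obtain ⟨M, hM, hMη⟩ : ∃ M : ℝ, 0 < M ∧ ENNReal.ofReal (V / M) ≤ η / 2 := by
    have h1 : Tendsto (fun M : ℝ => ENNReal.ofReal (V / M)) atTop (𝓝 0) := by
      have := ENNReal.tendsto_ofReal ((tendsto_const_nhds (x := V)).div_atTop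
        (tendsto_id (α := ℝ) (x := atTop)))
      simpa using this
    have h2 := (ENNReal.tendsto_nhds_zero.1 h1) (η / 2) (ENNReal.half_pos hη.ne')
    obtain ⟨M, hM⟩ := (h2.and (eventually_gt_atTop 0)).exists
    exact ⟨M, hM.2, hM.1⟩
  obtain ⟨T, δ, hδ, hdet⟩ := pc_det ⟨γ, hγ⟩ hε (by positivity : 0 < 1 + M)
  have hsum : Tendsto (fun n => ∑ t ∈ T,
      ENNReal.ofReal ((∫ ω, ‖charFun (ν n ω) t - charFun γ t‖ ^ 2 ∂P) / δ ^ 2)) atTop (𝓝 0) := by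
    have : (0 : ℝ≥0∞) = ∑ t ∈ T, 0 := by simp
    rw [this]
    refine tendsto_finsetSum _ fun t _ => ?_
    have := ENNReal.tendsto_ofReal ((hconv t).div_const (δ ^ 2))
    simpa using this
  filter_upwards [hQ, (ENNReal.tendsto_nhds_zero.1 hsum) (η / 2) (ENNReal.half_pos hη.ne')]
    with n hn1 hn2
  have hsub : {ω | ε ≤ levyProkhorovDist (ν n ω) γ} ⊆ {ω | M ≤ Q n ω} ∪
      ⋃ t ∈ T, {ω | δ ^ 2 ≤ ‖charFun (ν n ω) t - charFun γ t‖ ^ 2} := by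
    intro ω hω
    by_contra hno
    simp only [Set.mem_union, Set.mem_setOf_eq, Set.mem_iUnion, not_or, not_exists, not_le] at hno
    have := hdet ⟨ν n ω, hν n ω⟩ (fun s t => (hlip n ω s t).trans (by
      gcongr; exact hno.1.le)) (fun t ht => lt_of_pow_lt_pow_left₀ 2 hδ.le (hno.2 t ht))
    exact absurd hω (not_le.2 this)
  calc _ ≤ P ({ω | M ≤ Q n ω} ∪
      ⋃ t ∈ T, {ω | δ ^ 2 ≤ ‖charFun (ν n ω) t - charFun γ t‖ ^ 2}) := measure_mono hsub
    _ ≤ P {ω | M ≤ Q n ω} + ∑ t ∈ T, P {ω | δ ^ 2 ≤ ‖charFun (ν n ω) t - charFun γ t‖ ^ 2} :=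
        (measure_union_le _ _).trans (add_le_add le_rfl (measure_biUnion_finset_le _ _))
    _ ≤ ENNReal.ofReal (V / M) + ∑ t ∈ T,
      ENNReal.ofReal ((∫ ω, ‖charFun (ν n ω) t - charFun γ t‖ ^ 2 ∂P) / δ ^ 2) := by
        refine add_le_add ((pc_markov (hQ0 n) hn1.1 hM).trans ?_) (sum_le_sum fun t _ => ?_)
        · apply ENNReal.ofReal_le_ofReal; gcongr; exact hn1.2
        · exact pc_markov (fun ω => by positivity) (hint n t) (by positivity)
    _ ≤ η / 2 + η / 2 := add_le_add hMη hn2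
    _ = η := ENNReal.add_halves η



lemma pc_f2 {q r : ℕ} {Ω : Type*} [MeasurableSpace Ω] (P : Measure Ω)
    [IsProbabilityMeasure P]
    (X : ℕ → Ω → EuclideanSpace ℝ (Fin q)) (hXm : ∀ i, Measurable (X i))
    (hindep : iIndepFun X P) {μ : Measure (EuclideanSpace ℝ (Fin q))}
    (hμ : ∀ i, Measure.map (X i) P = μ)
    (f : EuclideanSpace ℝ (Fin q) → EuclideanSpace ℝ (Fin r)) (hfm : Measurable f)
    (hfsq : Integrable (fun ω => ‖f (X 0 ω - X 1 ω)‖ ^ 2) P) :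
    Measurable (Function.uncurry (f2v P X f)) ∧
    MemLp (Function.uncurry (f2v P X f)) 2 (μ.prod μ) ∧
    (∀ᵐ x ∂μ, ∫ z, f2v P X f x z ∂μ = 0) ∧ (∀ᵐ x ∂μ, ∫ z, f2v P X f z x ∂μ = 0) := by
  have hprob : IsProbabilityMeasure μ := by
    rw [← hμ 0]; exact Measure.isProbabilityMeasure_map (hXm 0).aemeasurable
  have hmp : MeasurePreserving (fun ω => (X 0 ω, X 1 ω)) P (μ.prod μ) :=
    ⟨(hXm 0).prodMk (hXm 1), pc_joint hXm hindep hμ zero_ne_one⟩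
  set k : EuclideanSpace ℝ (Fin q) → EuclideanSpace ℝ (Fin q) → EuclideanSpace ℝ (Fin r) :=
    fun x y => fS f (x - y) with hk
  have hks : ∀ x y, k x y = k y x := by
    intro x y
    simp only [hk, fS, neg_sub]
    rw [add_comm]
  have hkm : Measurable (Function.uncurry k) := by
    have : Measurable (fS f) := by unfold fS; fun_prop
    exact this.comp (measurable_fst.sub measurable_snd)
  set u : EuclideanSpace ℝ (Fin q) × EuclideanSpace ℝ (Fin q) → EuclideanSpace ℝ (Fin r) :=
    fun p => f (p.1 - p.2) with hu
  have hum : Measurable u := by rw [hu]; fun_prop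
  have huL : MemLp u 2 (μ.prod μ) := by
    rw [memLp_two_iff_integrable_sq_norm hum.aestronglyMeasurable, ← hmp.map_eq,
      integrable_map_measure (by fun_prop) hmp.measurable.aemeasurable]
    exact hfsq
  have huL' : MemLp (fun p => u p.swap) 2 (μ.prod μ) :=
    huL.comp_measurePreserving Measure.measurePreserving_swap
  have hkeq : Function.uncurry k = fun p => (2 : ℝ)⁻¹ • (u p + u p.swap) := by
    ext p : 1
    simp [hk, fS, hu, Function.uncurry]
  have hkL : MemLp (Function.uncurry k) 2 (μ.prod μ) := by
    rw [hkeq]; exact (huL.add huL').const_smul (2 : ℝ)⁻¹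
  have hki := hkL.integrable one_le_two
  set m : EuclideanSpace ℝ (Fin q) → EuclideanSpace ℝ (Fin r) := fun x => ∫ z, k x z ∂μ with hm
  have hmm : Measurable m :=
    (StronglyMeasurable.integral_prod_right (f := k) hkm.stronglyMeasurable).measurable
  have hm1 : ∀ x, ∫ ω, fS f (x - X 0 ω) ∂P = m x := by
    intro x
    rw [hm, ← hμ 0]
    exact (integral_map (hXm 0).aemeasurable
      (hkm.comp measurable_prodMk_left).aestronglyMeasurable).symm
  have hmi : Integrable m μ := hki.integral_prod_left
  have hf0 : f0v P X f = ∫ x, m x ∂μ := by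
    have h1 : f0v P X f = ∫ p, u p ∂(μ.prod μ) := by
      rw [f0v, ← hmp.map_eq, integral_map hmp.measurable.aemeasurable hum.aestronglyMeasurable]
    have h2 : ∫ p, u p.swap ∂(μ.prod μ) = ∫ p, u p ∂(μ.prod μ) := integral_prod_swap u
    have h3 : ∫ p, Function.uncurry k p ∂(μ.prod μ) = ∫ p, u p ∂(μ.prod μ) := by
      rw [hkeq, integral_smul, integral_add (huL.integrable one_le_two) (huL'.integrable one_le_two),
        h2, ← two_smul ℝ, smul_smul]
      norm_num
    rw [h1, ← h3, integral_prod _ hki]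
    rfl
  have hf2 : ∀ x y, f2v P X f x y = k x y - m x - m y + f0v P X f := by
    intro x y
    simp only [f2v, f1v, hm1]
    change k x y - f0v P X f - (m x - f0v P X f) - (m y - f0v P X f) = _
    abel
  have hf2s : ∀ x y, f2v P X f x y = f2v P X f y x := by
    intro x y
    rw [hf2, hf2, hks x y]; abel
  have hmL : MemLp m 2 μ := by
    rw [memLp_two_iff_integrable_sq_norm hmm.aestronglyMeasurable]
    have hsq : Integrable (fun p => ‖Function.uncurry k p‖ ^ 2) (μ.prod μ) :=
      (memLp_two_iff_integrable_sq_norm hkm.aestronglyMeasurable).1 hkL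
    refine hsq.integral_prod_left.mono' (by fun_prop) ?_
    filter_upwards [hsq.prod_right_ae] with x hx
    rw [Real.norm_of_nonneg (by positivity)]
    have hkx : AEStronglyMeasurable (fun z => ‖k x z‖) μ :=
      (hkm.comp measurable_prodMk_left).norm.aestronglyMeasurable
    calc ‖m x‖ ^ 2 ≤ (∫ z, ‖k x z‖ ∂μ) ^ 2 :=
          pow_le_pow_left₀ (norm_nonneg _) (norm_integral_le_integral_norm _) 2
      _ ≤ ∫ z, ‖k x z‖ ^ 2 ∂μ := pc_jensen ((memLp_two_iff_integrable_sq hkx).2 hx)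
  have hd : ∀ᵐ x ∂μ, ∫ z, f2v P X f x z ∂μ = 0 := by
    filter_upwards [hki.prod_right_ae] with x hx
    have hx' : Integrable (fun z => k x z) μ := hx
    simp_rw [hf2]
    rw [integral_add, integral_sub, integral_sub hx' (integrable_const _)]
    · simp only [integral_const, probReal_univ, one_smul]
      rw [hf0]
      change m x - m x - _ + _ = 0
      abel
    · exact hx'.sub (integrable_const _)
    · exact hmi
    · exact (hx'.sub (integrable_const _)).sub hmi
    · exact integrable_const _
  refine ⟨?_, ?_, hd, ?_⟩
  · have : Function.uncurry (f2v P X f) = fun p => Function.uncurry k p - m p.1 - m p.2 + f0v P X f := by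
      ext p : 1; exact hf2 p.1 p.2
    rw [this]
    fun_prop
  · have : Function.uncurry (f2v P X f) = fun p => Function.uncurry k p - m p.1 - m p.2 + f0v P X f := by
      ext p : 1; exact hf2 p.1 p.2
    rw [this]
    exact ((hkL.sub (hmL.comp_measurePreserving measurePreserving_fst)).sub
      (hmL.comp_measurePreserving measurePreserving_snd)).add (memLp_const _)
  · filter_upwards [hd] with x hx
    rw [← hx]
    exact integral_congr_ae (ae_of_all _ fun z => hf2s z x)

lemma pc_quad {r : ℕ} {Ω : Type*} [MeasurableSpace Ω] (P : Measure Ω)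
    [IsProbabilityMeasure P] {Y : Ω → EuclideanSpace ℝ (Fin r)} (hY : MemLp Y 2 P)
    (hY0 : ∀ i, ∫ ω, Y ω i ∂P = 0) (t : EuclideanSpace ℝ (Fin r)) :
    quadForm (covM P Y) t = ∫ ω, ⟪t, Y ω⟫ ^ 2 ∂P := by
  have hYi : ∀ i, MemLp (fun ω => Y ω i) 2 P := by
    intro i
    have := hY.const_inner (𝕜 := ℝ) (EuclideanSpace.single i (1 : ℝ))
    simpa [EuclideanSpace.inner_single_left] using this
  have hint : ∀ i j, Integrable (fun ω => t i * (Y ω i * Y ω j) * t j) P := fun i j =>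
    (((hYi i).integrable_mul (hYi j)).const_mul _).mul_const _
  have e : ∀ ω, ⟪t, Y ω⟫ ^ 2 = ∑ i, ∑ j, t i * (Y ω i * Y ω j) * t j := by
    intro ω
    have : ⟪t, Y ω⟫ = ∑ i, t i * Y ω i := by
      rw [PiLp.inner_apply]; simp [mul_comm]
    rw [this, sq, sum_mul_sum]
    refine sum_congr rfl fun i _ => sum_congr rfl fun j _ => ?_
    ring
  simp_rw [e]
  rw [integral_finsetSum _ fun i _ => integrable_finsetSum _ fun j _ => hint i j]
  unfold quadForm
  refine sum_congr rfl fun i _ => ?_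
  rw [integral_finsetSum _ fun j _ => hint i j]
  refine sum_congr rfl fun j _ => ?_
  rw [integral_mul_const, integral_const_mul]
  simp [covM, hY0]

lemma pc_gauss {r : ℕ} (S : Matrix (Fin r) (Fin r) ℝ) (hS : ∀ i j, S i j = S j i)
    (hS0 : ∀ t, 0 ≤ quadForm S t) :
    ∃ γ : Measure (EuclideanSpace ℝ (Fin r)), IsProbabilityMeasure γ ∧
      (∀ t, charFun γ t = (Real.exp (-(quadForm S t) / 2) : ℝ)) ∧
      (∀ a : EuclideanSpace ℝ (Fin r), Measure.map (fun z => ⟪a, z⟫) γ =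
          gaussianReal 0 (Real.toNNReal (quadForm S a))) := by
  have hq : ∀ t : EuclideanSpace ℝ (Fin r), t.ofLp ⬝ᵥ (S.mulVec t.ofLp) = quadForm S t := by
    intro t
    simp only [dotProduct, Matrix.mulVec, quadForm, mul_sum]
    refine sum_congr rfl fun i _ => sum_congr rfl fun j _ => ?_
    ring
  have hP : S.PosSemidef := by
    refine Matrix.PosSemidef.of_dotProduct_mulVec_nonneg ?_ fun x => ?_
    · ext i j; simp [hS j i]
    · have := hS0 (WithLp.toLp 2 x)
      rw [← hq] at this
      simpa using this
  have hch : ∀ t, charFun (multivariateGaussian 0 S) t = (Real.exp (-(quadForm S t) / 2) : ℝ) := by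
    intro t
    rw [charFun_multivariateGaussian hP, hq]
    simp only [inner_zero_right]
    push_cast
    congr 1
    ring
  refine ⟨multivariateGaussian 0 S, inferInstance, hch, fun a => ?_⟩
  have hmeas : Measurable fun z : EuclideanSpace ℝ (Fin r) => ⟪a, z⟫ := by fun_prop
  have : IsProbabilityMeasure (Measure.map (fun z => ⟪a, z⟫) (multivariateGaussian 0 S)) :=
    Measure.isProbabilityMeasure_map hmeas.aemeasurable
  apply Measure.ext_of_charFun
  ext t
  rw [charFun_gaussianReal, charFun_apply_real, integral_map hmeas.aemeasurable (by fun_prop)]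
  have h1 := hch (t • a)
  have h2 : quadForm S (t • a) = t ^ 2 * quadForm S a := by
    simp only [quadForm, mul_sum]
    refine sum_congr rfl fun i _ => sum_congr rfl fun j _ => ?_
    simp; ring
  rw [charFun_apply, h2] at h1
  have h3 : ∀ x : EuclideanSpace ℝ (Fin r), ⟪x, t • a⟫ = t * ⟪a, x⟫ := by
    intro x; rw [real_inner_smul_right, real_inner_comm]
  simp only [h3] at h1
  push_cast at h1
  rw [h1]
  congr 1
  simp [Real.coe_toNNReal _ (hS0 a)]
  ring



def pcV {Ω E F : Type*} [NormedAddCommGroup F] [InnerProductSpace ℝ F] (X : ℕ → Ω → E) (n : ℕ)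
    (k : E → E → F) (π : Equiv.Perm (Fin n)) (ω : Ω) : F :=
  (Real.sqrt n)⁻¹ • ∑ i : Fin n, k (X (π i) ω) (X (π (finRotate n i)) ω)

lemma pcW_inner {Ω E F : Type*} [NormedAddCommGroup F] [InnerProductSpace ℝ F] (X : ℕ → Ω → E)
    (n : ℕ) (k : E → E → F) (π : Equiv.Perm (Fin n)) (ω : Ω) (t : F) :
    pcW X n (fun x y => ⟪t, k x y⟫) π ω = ⟪t, pcV X n k π ω⟫ := by
  simp only [pcW, pcV, pcA, pcB, real_inner_smul_right, inner_sum, mul_sum]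

lemma pc_condprob {Ω : Type*} [MeasurableSpace Ω] {q r : ℕ} (P : Measure Ω) (n : ℕ)
    (X : ℕ → Ω → EuclideanSpace ℝ (Fin q))
    (f : EuclideanSpace ℝ (Fin q) → EuclideanSpace ℝ (Fin r)) (ω : Ω) :
    IsProbabilityMeasure (condLawPerm P n X f ω) := by
  constructor
  have h0 : ((n.factorial : ℕ) : ℝ≥0∞) ≠ 0 := by exact_mod_cast n.factorial_pos.ne'
  simp only [condLawPerm, Measure.smul_apply, Measure.finsetSum_apply, measure_univ, sum_const,
    card_univ, Fintype.card_perm, Fintype.card_fin, smul_eq_mul, nsmul_eq_mul, mul_one]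
  exact ENNReal.inv_mul_cancel h0 (ENNReal.natCast_ne_top _)

lemma pc_condchar {Ω : Type*} [MeasurableSpace Ω] {q r : ℕ} (P : Measure Ω) (n : ℕ)
    (X : ℕ → Ω → EuclideanSpace ℝ (Fin q))
    (f : EuclideanSpace ℝ (Fin q) → EuclideanSpace ℝ (Fin r)) (ω : Ω)
    (t : EuclideanSpace ℝ (Fin r)) :
    charFun (condLawPerm P n X f ω) t = pcPhi X n (fun x y => ⟪t, f2v P X f x y⟫) ω := by
  rw [charFun_apply, condLawPerm, integral_smul_measure, integral_finsetSum_measure]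
  · rw [pcPhi, ENNReal.toReal_inv, ENNReal.toReal_natCast, Complex.real_smul]
    congr 1
    · push_cast; rfl
    · refine sum_congr rfl fun π _ => ?_
      rw [integral_dirac, pcW_inner, mul_comm, real_inner_comm]
      rfl
  · intro π _
    exact integrable_dirac (by simp)

lemma pc_condlip {Ω E : Type*} {r : ℕ} (X : ℕ → Ω → E) (n : ℕ)
    (k : E → E → EuclideanSpace ℝ (Fin r)) (ω : Ω) (s t : EuclideanSpace ℝ (Fin r)) :
    ‖pcPhi X n (fun x y => ⟪s, k x y⟫) ω - pcPhi X n (fun x y => ⟪t, k x y⟫) ω‖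
      ≤ (1 + (n.factorial : ℝ)⁻¹ * ∑ π : Equiv.Perm (Fin n), ∑ j : Fin r,
        pcW X n (fun x y => ⟪EuclideanSpace.single j (1 : ℝ), k x y⟫) π ω ^ 2) * ‖s - t‖ := by
  have hN : (0 : ℝ) < n.factorial := by exact_mod_cast n.factorial_pos
  rw [pcPhi, pcPhi, ← mul_sub, ← sum_sub_distrib, norm_mul]
  have e1 : ‖((n.factorial : ℂ))⁻¹‖ = (n.factorial : ℝ)⁻¹ := by simp
  rw [e1]
  calc _ ≤ (n.factorial : ℝ)⁻¹ * ∑ π : Equiv.Perm (Fin n), (1 + ∑ j : Fin r,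
        pcW X n (fun x y => ⟪EuclideanSpace.single j (1 : ℝ), k x y⟫) π ω ^ 2) * ‖s - t‖ := by
        gcongr
        refine (norm_sum_le _ _).trans (sum_le_sum fun π _ => (pc_exp_lip _ _).trans ?_)
        simp only [pcW_inner]
        rw [← inner_sub_left, mul_comm]
        refine (abs_real_inner_le_norm _ _).trans ?_
        gcongr
        have e2 : ∑ j : Fin r, ⟪EuclideanSpace.single j (1 : ℝ), pcV X n k π ω⟫ ^ 2
            = ‖pcV X n k π ω‖ ^ 2 := by
          rw [EuclideanSpace.real_norm_sq_eq]
          refine sum_congr rfl fun j _ => ?_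
          rw [EuclideanSpace.inner_single_left]; simp
        rw [e2]
        nlinarith [sq_nonneg (‖pcV X n k π ω‖ - 1), norm_nonneg (pcV X n k π ω)]
    _ = _ := by
        rw [← sum_mul, ← mul_assoc, sum_add_distrib, mul_add]
        simp [Fintype.card_perm, hN.ne']

lemma pc_memLpV {Ω E F : Type*} [MeasurableSpace Ω] [MeasurableSpace E] [NormedAddCommGroup F]
    {P : Measure Ω} {ρ : Measure (E × E)} {x y : Ω → E} {k : E → E → F}
    (hmp : MeasurePreserving (fun ω => (x ω, y ω)) P ρ) (hL : MemLp (Function.uncurry k) 2 ρ) :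
    MemLp (fun ω => k (x ω) (y ω)) 2 P :=
  hL.comp_measurePreserving hmp

set_option maxHeartbeats 200000 in
theorem pc_main {q r : ℕ} {Ω : Type*} [MeasurableSpace Ω] (P : Measure Ω)
    [IsProbabilityMeasure P]
    (X : ℕ → Ω → EuclideanSpace ℝ (Fin q)) (hXm : ∀ i, Measurable (X i))
    (hindep : iIndepFun X P)
    (hident : ∀ i, Measure.map (X i) P = Measure.map (X 0) P)
    (f : EuclideanSpace ℝ (Fin q) → EuclideanSpace ℝ (Fin r)) (hfm : Measurable f)
    (hfsq : Integrable (fun ω => ‖f (X 0 ω - X 1 ω)‖ ^ 2) P) :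
    ∃ γ : Measure (EuclideanSpace ℝ (Fin r)),
      IsProbabilityMeasure γ ∧
      -- `γ = N_r(0, Γ_2)`
      (∀ a : EuclideanSpace ℝ (Fin r),
        Measure.map (fun z => ⟪a, z⟫) γ =
          gaussianReal 0 (Real.toNNReal
            (quadForm (covM P (fun ω => f2v P X f (X 0 ω) (X 1 ω))) a))) ∧
      ∀ ε : ℝ, 0 < ε →
        Tendsto (fun n : ℕ =>
            P {ω | ε ≤ levyProkhorovDist (condLawPerm P n X f ω) γ})
          atTop (𝓝 0) := by
  set μ := Measure.map (X 0) P with hμd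
  have hμ : ∀ i, Measure.map (X i) P = μ := hident
  have hprob : IsProbabilityMeasure μ := Measure.isProbabilityMeasure_map (hXm 0).aemeasurable
  obtain ⟨hkm, hkL, hk1, hk2⟩ := pc_f2 P X hXm hindep hμ f hfm hfsq
  set k := f2v P X f with hk
  have hmp : MeasurePreserving (fun ω => (X 0 ω, X 1 ω)) P (μ.prod μ) :=
    ⟨(hXm 0).prodMk (hXm 1), pc_joint hXm hindep hμ zero_ne_one⟩
  set h : EuclideanSpace ℝ (Fin r) → EuclideanSpace ℝ (Fin q) → EuclideanSpace ℝ (Fin q) → ℝ :=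
    fun t x y => ⟪t, k x y⟫ with hh
  have hhm : ∀ t, Measurable (Function.uncurry (h t)) := fun t =>
    (measurable_const (a := t)).inner hkm
  have hhL : ∀ t, MemLp (Function.uncurry (h t)) 2 (μ.prod μ) := fun t =>
    (hkL.const_inner (𝕜 := ℝ) t :)
  have hki := hkL.integrable one_le_two
  have hg2 : ∀ t, ∀ᵐ x ∂μ, ∫ z, h t x z ∂μ = 0 := by
    intro t
    filter_upwards [hk1, hki.prod_right_ae] with x hx hi
    have := integral_inner (𝕜 := ℝ) (f := fun z => k x z) hi t
    rw [hx, inner_zero_right] at this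
    exact this
  have hg1 : ∀ t, ∀ᵐ x ∂μ, ∫ z, h t z x ∂μ = 0 := by
    intro t
    filter_upwards [hk2, hki.prod_left_ae] with x hx hi
    have := integral_inner (𝕜 := ℝ) (f := fun z => k z x) hi t
    rw [hx, inner_zero_right] at this
    exact this
  set Y : Ω → EuclideanSpace ℝ (Fin r) := fun ω => k (X 0 ω) (X 1 ω) with hY
  have hYL : MemLp Y 2 P := pc_memLpV hmp hkL
  have hY0 : ∀ i, ∫ ω, Y ω i ∂P = 0 := by
    intro i
    have e : ∀ ω, Y ω i = h (EuclideanSpace.single i 1) (X 0 ω) (X 1 ω) := by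
      intro ω
      simp only [hh, EuclideanSpace.inner_single_left]; simp [hY]
    have e2 : ∫ p, Function.uncurry (h (EuclideanSpace.single i 1)) p ∂(μ.prod μ)
        = ∫ ω, h (EuclideanSpace.single i 1) (X 0 ω) (X 1 ω) ∂P := by
      rw [← hmp.map_eq]
      exact integral_map hmp.measurable.aemeasurable (hhm _).aestronglyMeasurable
    rw [integral_congr_ae (ae_of_all _ e), ← e2,
      integral_prod _ ((hhL (EuclideanSpace.single i 1)).integrable one_le_two)]
    exact integral_eq_zero_of_ae (hg2 (EuclideanSpace.single i 1))
  have hquad : ∀ t, quadForm (covM P Y) t = ∫ p, h t p.1 p.2 ^ 2 ∂(μ.prod μ) := by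
    intro t
    rw [pc_quad P hYL hY0, ← hmp.map_eq, integral_map hmp.measurable.aemeasurable
      (by exact ((hhm t).pow_const 2).aestronglyMeasurable)]
  obtain ⟨γ, hγ, hγc, hγm⟩ := pc_gauss (covM P Y)
    (fun i j => by simp only [covM, Matrix.of_apply, mul_comm])
    (fun t => by rw [hquad]; exact integral_nonneg fun p => sq_nonneg _)
  refine ⟨γ, hγ, hγm, fun ε hε => ?_⟩
  have hN : ∀ n : ℕ, (0 : ℝ) < n.factorial := fun n => by exact_mod_cast n.factorial_pos
  refine pc_prob γ (fun n ω => condLawPerm P n X f ω) (fun n ω => pc_condprob P n X f ω)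
    (fun n ω => (n.factorial : ℝ)⁻¹ * ∑ π : Equiv.Perm (Fin n), ∑ j : Fin r,
        pcW X n (h (EuclideanSpace.single j (1 : ℝ))) π ω ^ 2)
    (fun n ω => mul_nonneg (inv_nonneg.2 (hN n).le)
      (sum_nonneg fun _ _ => sum_nonneg fun _ _ => sq_nonneg _))
    (∑ j : Fin r, ∫ p, h (EuclideanSpace.single j (1 : ℝ)) p.1 p.2 ^ 2 ∂(μ.prod μ))
    ?_ (fun n ω s t => ?_) (fun n t => ?_) (fun t => ?_) hε
  · filter_upwards [eventually_ge_atTop 3] with n hn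
    have i1 : ∀ (π : Equiv.Perm (Fin n)) (j : Fin r), Integrable (fun ω =>
        pcW X n (h (EuclideanSpace.single j (1 : ℝ))) π ω ^ 2) P := fun π j =>
      (pcW_memLp hXm hindep hμ (hhL _) hn π).integrable_sq
    have i2 : ∀ (π : Equiv.Perm (Fin n)), Integrable (fun ω => ∑ j : Fin r,
        pcW X n (h (EuclideanSpace.single j (1 : ℝ))) π ω ^ 2) P := fun π =>
      integrable_finsetSum _ fun j _ => i1 π j
    refine ⟨(integrable_finsetSum _ fun π _ => i2 π).const_mul _, le_of_eq ?_⟩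
    rw [integral_const_mul, integral_finsetSum _ fun π _ => i2 π]
    have : ∀ π : Equiv.Perm (Fin n), ∫ ω, ∑ j : Fin r,
        pcW X n (h (EuclideanSpace.single j (1 : ℝ))) π ω ^ 2 ∂P
        = ∑ j : Fin r, ∫ p, h (EuclideanSpace.single j (1 : ℝ)) p.1 p.2 ^ 2 ∂(μ.prod μ) := by
      intro π
      rw [integral_finsetSum _ fun j _ => i1 π j]
      exact sum_congr rfl fun j _ => pcW_sq hXm hindep hμ (hhm _) (hhL _) (hg1 _) (hg2 _) hn π
    rw [sum_congr rfl fun π _ => this π, sum_const, card_univ, Fintype.card_perm, Fintype.card_fin,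
      nsmul_eq_mul, inv_mul_cancel_left₀ (hN n).ne']
  · rw [pc_condchar, pc_condchar]
    exact pc_condlip X n k ω s t
  · simp only [pc_condchar]
    have hm : Measurable (pcPhi X n (h t)) := pcPhi_meas hXm n (hhm t)
    refine pc_bint (K := 4) ((hm.sub_const _).norm.pow_const 2) fun ω => ?_
    rw [abs_of_nonneg (by positivity)]
    have h1 : ‖pcPhi X n (h t) ω‖ ≤ 1 := pcPhi_norm X n (h t) ω
    have h2 : ‖charFun γ t‖ ≤ 1 := norm_charFun_le_one t
    have h3 := norm_sub_le (pcPhi X n (h t) ω) (charFun γ t)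
    have h4 := norm_nonneg (pcPhi X n (h t) ω - charFun γ t)
    change ‖pcPhi X n (h t) ω - charFun γ t‖ ^ 2 ≤ 4
    nlinarith
  · simp only [pc_condchar]
    rw [hγc, hquad]
    exact pc_L2 hXm hindep hμ (hhm t) (hhL t) (hg1 t) (hg2 t)


/-- Proposition 3: the Lévy–Prokhorov distance between the conditional law
of `√n M̃_{n,1}` given the data and `N_r(0, Γ_2)` tends to zero in probability. -/
theorem stmt13 {q r : ℕ} {Ω : Type*} [MeasurableSpace Ω] (P : Measure Ω)
    [IsProbabilityMeasure P]
    (X : ℕ → Ω → EuclideanSpace ℝ (Fin q)) (hXm : ∀ i, Measurable (X i))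
    (hindep : iIndepFun X P)
    (hident : ∀ i, Measure.map (X i) P = Measure.map (X 0) P)
    (f : EuclideanSpace ℝ (Fin q) → EuclideanSpace ℝ (Fin r)) (hfm : Measurable f)
    (hfsq : Integrable (fun ω => ‖f (X 0 ω - X 1 ω)‖ ^ 2) P) :
    ∃ γ : Measure (EuclideanSpace ℝ (Fin r)),
      IsProbabilityMeasure γ ∧
      -- `γ = N_r(0, Γ_2)`
      (∀ a : EuclideanSpace ℝ (Fin r),
        Measure.map (fun z => ⟪a, z⟫) γ =
          gaussianReal 0 (Real.toNNReal
            (quadForm (covM P (fun ω => f2v P X f (X 0 ω) (X 1 ω))) a))) ∧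
      ∀ ε : ℝ, 0 < ε →
        Tendsto (fun n : ℕ =>
            P {ω | ε ≤ levyProkhorovDist (condLawPerm P n X f ω) γ})
          atTop (𝓝 0) := by
  exact pc_main P X hXm hindep hident f hfm hfsq
end
end

section
/- Let Π be a uniformly distributed random permutation of {1,...,n} with the convention Π(n+1) := Π(1). Then on the same probability space there exist random permutations B and B* of {1,...,n} (both measurable functions of Π) such that: (i) B is uniformly distributed on the set of all permutations of {1,...,n}; (ii) B* almost surely consists of a single n-cycle; (iii) for every matrix A ∈ R^{n×n}, Σ_{i=1}^n A_{Π(i),Π(i+1)} = Σ_{i=1}^n A_{i,B*(i)}; and (iv) E( #{ i ∈ {1,...,n} : B(i) ≠ B*(i) } ) ≤ 1 + log(n). -/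
open MeasureTheory ProbabilityTheory Finset
open scoped ENNReal

noncomputable section

instance permMS (n : ℕ) : MeasurableSpace (Equiv.Perm (Fin n)) := ⊤

/-- A permutation `σ` of `{1,...,n}` is a single `n`-cycle if it is of the form
`a_1 ↦ a_2 ↦ ... ↦ a_n ↦ a_1` for pairwise distinct `a_1,...,a_n` enumerating the set. -/
def IsSingleNCycle {n : ℕ} (σ : Equiv.Perm (Fin n)) : Prop :=
  ∃ a : Fin n → Fin n, Function.Bijective a ∧ ∀ i, σ (a i) = a (finRotate n i)

/-- insert the value 0 at position j into the word w -/
def insW {n : ℕ} (j : Fin (n+1)) (w : Equiv.Perm (Fin n)) : Equiv.Perm (Fin (n+1)) :=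
  (finSuccEquiv' j).trans ((Equiv.optionCongr w).trans (finSuccEquiv' 0).symm)

lemma insW_at {n : ℕ} (j : Fin (n+1)) (w : Equiv.Perm (Fin n)) : insW j w j = 0 := by
  simp [insW]

lemma insW_succAbove {n : ℕ} (j : Fin (n+1)) (w : Equiv.Perm (Fin n)) (i : Fin n) :
    insW j w (j.succAbove i) = (w i).succ := by
  simp [insW]

lemma insW_bij (n : ℕ) :
    Function.Bijective (fun x : Fin (n+1) × Equiv.Perm (Fin n) => insW x.1 x.2) := by
  rw [Fintype.bijective_iff_injective_and_card]
  constructor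
  · rintro ⟨j, w⟩ ⟨j', w'⟩ h
    simp only at h
    have hj : j = j' := by
      apply (insW j w).injective
      rw [insW_at, h, insW_at]
    subst hj
    congr 1
    ext i
    have := insW_succAbove j w i
    rw [h, insW_succAbove] at this
    rw [Fin.succ_injective _ this]
  · simp [Fintype.card_perm, Nat.factorial_succ]

def qPos {n : ℕ} (j : Fin (n+1)) (w : Equiv.Perm (Fin n)) : Fin (n+1) :=
  Fin.cases 0 (fun i => (w i).succ) j

lemma qPos_inj {n : ℕ} (w : Equiv.Perm (Fin n)) : Function.Injective (fun j => qPos j w) := by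
  intro a b
  refine Fin.cases ?_ (fun i => ?_) a <;> refine Fin.cases ?_ (fun i' => ?_) b <;>
    simp [qPos, (Fin.succ_ne_zero _).symm]

def good {m : ℕ} (χ w : Equiv.Perm (Fin (m+1))) : Finset (Fin m) :=
  univ.filter fun i => χ (w i.succ) = w i.castSucc

lemma good_zero {m : ℕ} (χ w : Equiv.Perm (Fin (m+1))) :
    (good χ w).card ≤
      (good (Equiv.Perm.decomposeFin.symm (qPos 0 w, χ)) (insW 0 w)).card := by
  refine Finset.card_le_card_of_injOn Fin.succ ?_ ((Fin.succ_injective _).injOn)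
  intro k hk
  simp only [good, coe_filter, mem_univ, true_and, Set.mem_ofPred_eq] at hk ⊢
  have h1 := insW_succAbove 0 w k.succ
  have h2 := insW_succAbove 0 w k.castSucc
  simp only [Fin.zero_succAbove] at h1 h2
  rw [h1, ← Fin.succ_castSucc, h2]
  simp [qPos, hk]

lemma good_succ {m : ℕ} (i₀ : Fin (m+1)) (χ w : Equiv.Perm (Fin (m+1))) :
    (good χ w).card + 1 ≤
      (good (Equiv.Perm.decomposeFin.symm (qPos i₀.succ w, χ)) (insW i₀.succ w)).card := by
  have hq : qPos i₀.succ w = (w i₀).succ := rfl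
  have hd : ∀ k : Fin (m+1), i₀.succ.succAbove k = if k ≤ i₀ then k.castSucc else k.succ := by
    intro k
    split_ifs with h
    · exact Fin.succAbove_of_castSucc_lt _ _ (by
        simp only [Fin.lt_def, Fin.le_def, Fin.val_succ, Fin.val_castSucc] at h ⊢; omega)
    · exact Fin.succAbove_of_le_castSucc _ _ (by
        simp only [Fin.le_def, Fin.val_succ, Fin.val_castSucc] at h ⊢; omega)
  have hi : i₀ ∈ good (Equiv.Perm.decomposeFin.symm (qPos i₀.succ w, χ)) (insW i₀.succ w) := by
    have h := insW_succAbove i₀.succ w i₀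
    rw [hd, if_pos le_rfl] at h
    simp [good, insW_at, h, hq]
  have hn : i₀ ∉ (good χ w).image i₀.succAbove := by
    simp [Fin.succAbove_ne]
  rw [← Finset.card_image_of_injective (good χ w) (Fin.succAbove_right_injective (p := i₀)),
    ← Finset.card_insert_of_notMem hn]
  apply Finset.card_le_card
  rw [Finset.insert_subset_iff]
  refine ⟨hi, ?_⟩
  intro x hx
  obtain ⟨k, hk, rfl⟩ := Finset.mem_image.1 hx
  simp only [good, mem_filter, mem_univ, true_and] at hk ⊢
  rw [hq]
  have hs := insW_succAbove i₀.succ w k.succ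
  have hc := insW_succAbove i₀.succ w k.castSucc
  rw [hd] at hs hc
  rcases lt_trichotomy k.castSucc i₀ with h | h | h
  · -- k < i₀
    rw [Fin.succAbove_of_castSucc_lt _ _ h]
    rw [if_pos (by simp only [Fin.lt_def, Fin.le_def, Fin.val_succ, Fin.val_castSucc] at h ⊢; omega)] at hs
    rw [if_pos h.le] at hc
    rw [Fin.succ_castSucc, hs, hc, Equiv.Perm.decomposeFin_symm_apply_succ, hk,
      Equiv.swap_apply_of_ne_of_ne (Fin.succ_ne_zero _)]
    intro h'
    exact h.ne (w.injective (Fin.succ_injective _ h'))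
  · rw [Fin.succAbove_of_le_castSucc _ _ h.ge]
    rw [if_neg (by rw [← h]; simp [Fin.lt_def, Fin.le_def])] at hs
    subst h
    rw [hs, Equiv.Perm.decomposeFin_symm_apply_succ, hk, Equiv.swap_apply_right,
      ← Fin.succ_castSucc, insW_at]
  · rw [Fin.succAbove_of_le_castSucc _ _ h.le]
    rw [if_neg (by simp only [Fin.lt_def, Fin.le_def, Fin.val_succ, Fin.val_castSucc] at h ⊢; omega)] at hs
    rw [if_neg (not_le.2 h)] at hc
    rw [hs, ← Fin.succ_castSucc, hc, Equiv.Perm.decomposeFin_symm_apply_succ, hk,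
      Equiv.swap_apply_of_ne_of_ne (Fin.succ_ne_zero _)]
    intro h'
    exact h.ne' (w.injective (Fin.succ_injective _ h'))

lemma main_bij (m : ℕ) : ∃ χ : Equiv.Perm (Fin (m+1)) → Equiv.Perm (Fin (m+1)),
    Function.Bijective χ ∧
    ((m+1).factorial : ℝ) * ((m+1 : ℝ) - (harmonic (m+1) : ℝ)) ≤
      ∑ w, ((good (χ w) w).card : ℝ) := by
  induction m with
  | zero =>
    refine ⟨id, Function.bijective_id, ?_⟩
    simp [harmonic]
  | succ m ih =>
    obtain ⟨χ, hχ, hsum⟩ := ih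
    let I := Equiv.ofBijective _ (insW_bij (m+1))
    let J : Fin (m+2) × Equiv.Perm (Fin (m+1)) → Fin (m+2) × Equiv.Perm (Fin (m+1)) :=
      fun x => (qPos x.1 x.2, χ x.2)
    have hJ : Function.Bijective J := by
      rw [← Finite.injective_iff_bijective]
      rintro ⟨j, w⟩ ⟨j', w'⟩ h
      simp only [J, Prod.mk.injEq] at h
      obtain ⟨h1, h2⟩ := h
      have := hχ.1 h2
      subst this
      rw [qPos_inj w h1]
    refine ⟨fun w => Equiv.Perm.decomposeFin.symm (J (I.symm w)),
      Equiv.Perm.decomposeFin.symm.bijective.comp (hJ.comp I.symm.bijective), ?_⟩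
    rw [← I.sum_comp, Fintype.sum_prod_type_right]
    simp only [Equiv.symm_apply_apply]
    have key : ∀ w : Equiv.Perm (Fin (m+1)),
        ((m:ℝ)+2) * ((good (χ w) w).card : ℝ) + (m+1) ≤
        ∑ j : Fin (m+2), ((good (Equiv.Perm.decomposeFin.symm (J (j, w))) (I (j, w))).card : ℝ) := by
      intro w
      rw [Fin.sum_univ_succ]
      have h0 : ((good (χ w) w).card : ℝ) ≤
          ((good (Equiv.Perm.decomposeFin.symm (J (0, w))) (I (0, w))).card : ℝ) := by
        exact_mod_cast good_zero (χ w) w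
      have h1 : ∑ i : Fin (m+1), (((good (χ w) w).card : ℝ) + 1) ≤ ∑ i : Fin (m+1),
          ((good (Equiv.Perm.decomposeFin.symm (J (i.succ, w))) (I (i.succ, w))).card : ℝ) := by
        apply Finset.sum_le_sum
        intro i _
        exact_mod_cast good_succ i (χ w) w
      simp only [sum_const, card_univ, Fintype.card_fin, nsmul_eq_mul] at h1
      push_cast at h1
      linarith
    refine le_trans ?_ (Finset.sum_le_sum fun w _ => key w)
    rw [Finset.sum_add_distrib, ← Finset.mul_sum]
    simp only [sum_const, card_univ, Fintype.card_perm, Fintype.card_fin, nsmul_eq_mul]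
    rw [Nat.factorial_succ (m+1), harmonic_succ (m+1)]
    push_cast
    have h2 := mul_le_mul_of_nonneg_left hsum (by positivity : (0:ℝ) ≤ (m:ℝ)+2)
    have h3 : ((m:ℝ)+2) * ((m:ℝ)+1+1)⁻¹ = 1 := by
      rw [show (m:ℝ)+1+1 = m+2 by ring]; exact mul_inv_cancel₀ (by positivity)
    have h4 := congrArg (fun t => ((m+1).factorial : ℝ) * t) h3
    nlinarith [h2, h4]

lemma disc_le {m : ℕ} (χ w : Equiv.Perm (Fin (m+1))) :
    ((univ.filter fun i : Fin (m+1) => χ⁻¹ i ≠ (w * finRotate (m+1) * w⁻¹) i).card : ℝ) ≤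
      (m + 1 : ℝ) - ((good χ w).card : ℝ) := by
  have h1 : (good χ w).card ≤
      (univ.filter fun i : Fin (m+1) => χ⁻¹ i = (w * finRotate (m+1) * w⁻¹) i).card := by
    refine Finset.card_le_card_of_injOn (fun k => w k.castSucc) ?_
      ((w.injective.comp (Fin.castSucc_injective _)).injOn)
    intro k hk
    simp only [good, coe_filter, mem_univ, true_and, Set.mem_ofPred_eq] at hk ⊢
    rw [Equiv.Perm.inv_eq_iff_eq]
    simp [hk]
  have h2 := Finset.card_filter_add_card_filter_not (s := (univ : Finset (Fin (m+1))))
    (fun i : Fin (m+1) => χ⁻¹ i = (w * finRotate (m+1) * w⁻¹) i)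
  simp only [card_univ, Fintype.card_fin] at h2
  have h3 : (good χ w).card +
    (univ.filter fun i : Fin (m+1) => χ⁻¹ i ≠ (w * finRotate (m+1) * w⁻¹) i).card ≤ m + 1 := by
    simp only [ne_eq]; omega
  have h4 : ((good χ w).card : ℝ) +
    ((univ.filter fun i : Fin (m+1) => χ⁻¹ i ≠ (w * finRotate (m+1) * w⁻¹) i).card : ℝ) ≤ m + 1 := by
    exact_mod_cast h3
  linarith

lemma comb (n : ℕ) : ∃ φ : Equiv.Perm (Fin n) → Equiv.Perm (Fin n), Function.Bijective φ ∧
    ∑ w : Equiv.Perm (Fin n),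
      ((univ.filter fun i : Fin n => φ w i ≠ (w * finRotate n * w⁻¹) i).card : ℝ) ≤
      (n.factorial : ℝ) * (1 + Real.log n) := by
  rcases n with _ | m
  · exact ⟨id, Function.bijective_id, by simp⟩
  obtain ⟨χ, hχ, hs⟩ := main_bij m
  refine ⟨fun w => (χ w)⁻¹, (Equiv.inv _).bijective.comp hχ, ?_⟩
  refine (Finset.sum_le_sum fun w _ => disc_le (χ w) w).trans ?_
  rw [Finset.sum_sub_distrib]
  simp only [sum_const, card_univ, Fintype.card_perm, Fintype.card_fin, nsmul_eq_mul]
  have h := mul_le_mul_of_nonneg_left (harmonic_le_one_add_log (m+1))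
    (by positivity : (0:ℝ) ≤ ((m+1).factorial : ℝ))
  linarith

/-- coupling of a uniform random permutation `Π` with a uniform random
permutation `B` and a random single `n`-cycle `B*`, both measurable functions of `Π`,
which agree except at `≤ 1 + log n` positions in expectation, and such that
`∑_i A_{Π(i),Π(i+1)} = ∑_i A_{i,B*(i)}` for every matrix `A`. -/
theorem stmt17 {n : ℕ} {Ω : Type*} [MeasurableSpace Ω] (P : Measure Ω)
    [IsProbabilityMeasure P]
    (Pi : Ω → Equiv.Perm (Fin n)) (hPim : Measurable Pi)
    (hPiUnif : Measure.map Pi P = ((n.factorial : ℕ) : ℝ≥0∞)⁻¹ • Measure.count) :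
    ∃ φ φs : Equiv.Perm (Fin n) → Equiv.Perm (Fin n),
      -- (i) `B := φ ∘ Π` is uniformly distributed
      (Measure.map (fun ω => φ (Pi ω)) P =
        ((n.factorial : ℕ) : ℝ≥0∞)⁻¹ • Measure.count) ∧
      -- (ii) `B* := φs ∘ Π` is almost surely a single `n`-cycle
      (∀ᵐ ω ∂P, IsSingleNCycle (φs (Pi ω))) ∧
      -- (iii) `∑_i A_{Π(i),Π(i+1)} = ∑_i A_{i,B*(i)}` (cyclic convention `Π(n+1) := Π(1)`)
      (∀ ω, ∀ A : Matrix (Fin n) (Fin n) ℝ,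
        ∑ i : Fin n, A (Pi ω i) (Pi ω (finRotate n i)) =
          ∑ i : Fin n, A i (φs (Pi ω) i)) ∧
      -- (iv) expected number of discrepancies is at most `1 + log n`
      (∫ ω, ((univ.filter fun i : Fin n => φ (Pi ω) i ≠ φs (Pi ω) i).card : ℝ) ∂P ≤
        1 + Real.log n) := by
  obtain ⟨φ, hφ, hs⟩ := comb n
  have hmeas : ∀ {β : Type} [MeasurableSpace β] (f : Equiv.Perm (Fin n) → β), Measurable f :=
    fun f s _ => trivial
  haveI : MeasurableSingletonClass (Equiv.Perm (Fin n)) := ⟨fun _ => trivial⟩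
  refine ⟨φ, fun w => w * finRotate n * w⁻¹, ?_, ?_, ?_, ?_⟩
  · have : (fun ω => φ (Pi ω)) = φ ∘ Pi := rfl
    rw [this, ← Measure.map_map (hmeas φ) hPim, hPiUnif, Measure.map_smul]
    congr 1
    let e : Equiv.Perm (Fin n) ≃ᵐ Equiv.Perm (Fin n) :=
      ⟨Equiv.ofBijective φ hφ, hmeas _, hmeas _⟩
    ext s hs
    rw [Measure.map_apply (hmeas φ) hs, Measure.count_apply (hmeas φ hs), Measure.count_apply hs]
    rw [Set.encard_preimage_of_bijective hφ]
  · refine Filter.Eventually.of_forall fun ω => ⟨Pi ω, (Pi ω).bijective, fun i => ?_⟩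
    simp
  · intro ω A
    rw [← Equiv.sum_comp (Pi ω) (fun i => A i ((Pi ω * finRotate n * (Pi ω)⁻¹) i))]
    simp
  · have h := integral_map (μ := P) hPim.aemeasurable
      (f := fun w => ((univ.filter fun i : Fin n => φ w i ≠ (w * finRotate n * w⁻¹) i).card : ℝ))
      (hmeas _).aestronglyMeasurable
    rw [← h, hPiUnif, integral_smul_measure, integral_count]
    rw [ENNReal.toReal_inv, ENNReal.toReal_natCast, smul_eq_mul, inv_mul_le_iff₀ (by positivity)]
    exact hs
end
end

section
/- Define h(x) := |x|³ / √(1 + x²) for x ∈ R. Then: (i) h(x) ≤ x²·min(|x|, 1) ≤ √2 · h(x) for all x ∈ R; (ii) h is an even convex function on R with h(2x) ≤ 8·h(x) for all x; and (iii) for all x, y ∈ R, (x+y)²·min(|x+y|, 1) ≤ 6·x²·min(|x|, 1) + 6·y²·min(|y|, 1). -/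
noncomputable def hfun (x : ℝ) : ℝ := |x| ^ 3 / Real.sqrt (1 + x ^ 2)

noncomputable def gaux (t : ℝ) : ℝ := t ^ 3 / Real.sqrt (1 + t ^ 2)

lemma gaux_deriv (t : ℝ) : HasDerivAt gaux
    (2 * Real.sqrt (1 + t ^ 2) - 1 / Real.sqrt (1 + t ^ 2) - 1 / Real.sqrt (1 + t ^ 2) ^ 3) t := by
  have hp : 0 < 1 + t ^ 2 := by positivity
  have hs : 0 < Real.sqrt (1 + t ^ 2) := Real.sqrt_pos.2 hp
  have hsq : Real.sqrt (1 + t ^ 2) ^ 2 = 1 + t ^ 2 := Real.sq_sqrt hp.le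
  have h1 : HasDerivAt (fun t : ℝ => 1 + t ^ 2) (2 * t) t := by
    simpa using (hasDerivAt_pow 2 t).const_add 1
  have h2 := h1.sqrt hp.ne'
  have h3 := (hasDerivAt_pow 3 t).div h2 hs.ne'
  refine h3.congr_deriv ?_
  set s := Real.sqrt (1 + t ^ 2) with hsdef
  have e : t ^ 2 = s ^ 2 - 1 := by linarith
  have e4 : t ^ 3 * t = (s ^ 2 - 1) ^ 2 := by rw [← e]; ring
  have : (↑3 * t ^ (3 - 1) * s - t ^ 3 * (2 * t / (2 * s))) / s ^ 2
      = (3 * t ^ 2 * s ^ 2 - t ^ 3 * t) / s ^ 3 := by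
    field_simp
    try norm_num
    try ring
  push_cast
  rw [this, e4, e]
  field_simp
  ring

lemma gaux_convex : ConvexOn ℝ (Set.Ici 0) gaux := by
  have hd : Differentiable ℝ gaux := fun t => (gaux_deriv t).differentiableAt
  refine MonotoneOn.convexOn_of_deriv (convex_Ici 0) hd.continuous.continuousOn
    hd.differentiableOn ?_
  rw [interior_Ici]
  intro a ha b hb hab
  rw [(gaux_deriv a).deriv, (gaux_deriv b).deriv]
  have ha' : 0 < a := ha
  have hs : 0 < Real.sqrt (1 + a ^ 2) := Real.sqrt_pos.2 (by positivity)
  have hle : Real.sqrt (1 + a ^ 2) ≤ Real.sqrt (1 + b ^ 2) := by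
    apply Real.sqrt_le_sqrt; gcongr
  have h1 : 1 / Real.sqrt (1 + b ^ 2) ≤ 1 / Real.sqrt (1 + a ^ 2) := by gcongr
  have h2 : 1 / Real.sqrt (1 + b ^ 2) ^ 3 ≤ 1 / Real.sqrt (1 + a ^ 2) ^ 3 := by gcongr
  linarith

lemma hfun_eq (x : ℝ) : hfun x = gaux |x| := by
  simp [hfun, gaux]

lemma gaux_mono {a b : ℝ} (ha : 0 ≤ a) (hab : a ≤ b) : gaux a ≤ gaux b := by
  have hd : Differentiable ℝ gaux := fun t => (gaux_deriv t).differentiableAt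
  have : Monotone gaux := by
    apply monotone_of_deriv_nonneg hd
    intro t
    rw [(gaux_deriv t).deriv]
    have hs : 1 ≤ Real.sqrt (1 + t ^ 2) := Real.one_le_sqrt.2 (by nlinarith [sq_nonneg t])
    have h1 : 1 / Real.sqrt (1 + t ^ 2) ≤ 1 := by
      rw [div_le_one (by linarith)]; exact hs
    have h2 : 1 / Real.sqrt (1 + t ^ 2) ^ 3 ≤ 1 := by
      rw [div_le_one (by positivity)]; exact one_le_pow₀ hs
    linarith
  exact this hab

lemma hfun_convex : ConvexOn ℝ Set.univ hfun := by
  refine ⟨convex_univ, ?_⟩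
  intro x _ y _ a b ha hb hab
  have h := gaux_convex.2 (abs_nonneg x) (abs_nonneg y) ha hb hab
  simp only [hfun_eq]
  refine le_trans (gaux_mono (abs_nonneg _) ?_) h
  simp only [smul_eq_mul]
  refine (abs_add_le _ _).trans ?_
  rw [abs_mul, abs_mul, abs_of_nonneg ha, abs_of_nonneg hb]

lemma hfun_two (x : ℝ) : hfun (2 * x) ≤ 8 * hfun x := by
  have h1 : 0 < Real.sqrt (1 + x ^ 2) := Real.sqrt_pos.2 (by positivity)
  have hle : Real.sqrt (1 + x ^ 2) ≤ Real.sqrt (1 + (2 * x) ^ 2) := by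
    apply Real.sqrt_le_sqrt; nlinarith [sq_nonneg x]
  have : 8 * hfun x = |2 * x| ^ 3 / Real.sqrt (1 + x ^ 2) := by
    rw [abs_mul, hfun, abs_two]; ring
  rw [this, hfun]
  gcongr

lemma hfun_lo (x : ℝ) : hfun x ≤ x ^ 2 * min |x| 1 := by
  have h1 : 0 < Real.sqrt (1 + x ^ 2) := Real.sqrt_pos.2 (by positivity)
  have hs : 1 ≤ Real.sqrt (1 + x ^ 2) := Real.one_le_sqrt.2 (by nlinarith [sq_nonneg x])
  have hx : |x| ≤ Real.sqrt (1 + x ^ 2) := Real.abs_le_sqrt (by linarith)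
  rw [hfun, div_le_iff₀ h1, ← sq_abs x, mul_assoc, pow_succ]
  rw [sq_abs x]
  apply mul_le_mul_of_nonneg_left _ (sq_nonneg _)
  rcases min_cases |x| 1 with ⟨h, _⟩ | ⟨h, _⟩ <;> rw [h]
  · nlinarith [abs_nonneg x]
  · linarith

lemma hfun_hi (x : ℝ) : x ^ 2 * min |x| 1 ≤ Real.sqrt 2 * hfun x := by
  have h1 : 0 < Real.sqrt (1 + x ^ 2) := Real.sqrt_pos.2 (by positivity)
  have h0 := abs_nonneg x
  have key : min |x| 1 * Real.sqrt (1 + x ^ 2) ≤ Real.sqrt 2 * |x| := by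
    rcases min_cases |x| 1 with ⟨h, h'⟩ | ⟨h, h'⟩ <;> rw [h]
    · have : Real.sqrt (1 + x ^ 2) ≤ Real.sqrt 2 := by
        apply Real.sqrt_le_sqrt; rw [← sq_abs]; nlinarith
      nlinarith
    · rw [one_mul, ← Real.sqrt_sq h0, ← Real.sqrt_mul (by norm_num)]
      apply Real.sqrt_le_sqrt
      rw [← sq_abs x]; nlinarith
  rw [hfun, ← mul_div_assoc, le_div_iff₀ h1]
  have e : |x| ^ 3 = x ^ 2 * |x| := by rw [← sq_abs x]; ring
  rw [e]
  nlinarith [mul_le_mul_of_nonneg_left key (sq_nonneg x)]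

theorem stmt19 :
    (∀ x : ℝ, hfun x ≤ x ^ 2 * min |x| 1 ∧ x ^ 2 * min |x| 1 ≤ Real.sqrt 2 * hfun x) ∧
    ((∀ x : ℝ, hfun (-x) = hfun x) ∧ ConvexOn ℝ Set.univ hfun ∧
      ∀ x : ℝ, hfun (2 * x) ≤ 8 * hfun x) ∧
    (∀ x y : ℝ, (x + y) ^ 2 * min |x + y| 1 ≤
      6 * (x ^ 2 * min |x| 1) + 6 * (y ^ 2 * min |y| 1)) := by
  refine ⟨fun x => ⟨hfun_lo x, hfun_hi x⟩, ⟨fun x => by simp [hfun], hfun_convex, hfun_two⟩, ?_⟩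
  intro x y
  have hc := hfun_convex.2 (Set.mem_univ (2 * x)) (Set.mem_univ (2 * y))
    (by norm_num : (0 : ℝ) ≤ 1 / 2) (by norm_num : (0 : ℝ) ≤ 1 / 2) (by norm_num)
  simp only [smul_eq_mul] at hc
  rw [show (1 / 2 : ℝ) * (2 * x) + 1 / 2 * (2 * y) = x + y by ring] at hc
  have h2 : Real.sqrt 2 ≤ 3 / 2 := by
    rw [Real.sqrt_le_left (by norm_num)]; norm_num
  have hn : ∀ z, 0 ≤ hfun z := fun z => by unfold hfun; positivity
  have := hfun_hi (x + y)
  have := hfun_two x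
  have := hfun_two y
  have := hfun_lo x
  have := hfun_lo y
  have := mul_le_mul_of_nonneg_right h2 (hn (x + y))
  linarith
end
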